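/- arXiv:1012.5822 — 3 statements merged into one kernel-verified Lean document; each statement's English description precedes it below -/
import Mathlib

section
/- Let ω be a weight sequence, i.e. a sequence of positive real numbers ω(n) that is nondecreasing with ω(n) → ∞ and log ω(n) = o(n) as n → ∞. If ∑_{n≥1} (log ω(n))²/n² = ∞, then every bounded analytic function on the unit disk D without zeros in D is cyclic in the weighted Bergman space A²_ω. -/
open MeasureTheory Filter

/-- Taylor coefficient at 0. -/
noncomputable def taylorCoeff (f : ℂ → ℂ) (n : ℕ) : ℂ :=
  iteratedDeriv n f 0 / n.factorial

/-- Squared norm in the weighted Bergman space `A²_ω`. -/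
noncomputable def wNormSq (ω : ℕ → ℝ) (f : ℂ → ℂ) : ℝ :=
  ∑' n : ℕ, ‖taylorCoeff f n‖ ^ 2 / ω n ^ 2

/-- Membership in the weighted Bergman space `A²_ω`. -/
def MemA (ω : ℕ → ℝ) (f : ℂ → ℂ) : Prop :=
  AnalyticOnNhd ℂ f (Metric.ball (0 : ℂ) 1) ∧
    Summable (fun n : ℕ => ‖taylorCoeff f n‖ ^ 2 / ω n ^ 2)

/-- `f` is cyclic in `A²_ω`: polynomial multiples of `f` are dense. -/
def CyclicA (ω : ℕ → ℝ) (f : ℂ → ℂ) : Prop :=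
  MemA ω f ∧ ∀ g : ℂ → ℂ, MemA ω g → ∀ ε : ℝ, 0 < ε →
    ∃ p : Polynomial ℂ, MemA ω (fun z => p.eval z * f z - g z) ∧
      wNormSq ω (fun z => p.eval z * f z - g z) < ε ^ 2


local notation "𝔻" => Metric.ball (0 : ℂ) 1

lemma cd_of_diff {F : ℂ → ℂ} (hF : DifferentiableOn ℂ F 𝔻) (n : WithTop ℕ∞) : ContDiffAt ℂ n F 0 :=
  ((hF.analyticOnNhd Metric.isOpen_ball) 0 (by simp)).contDiffAt

lemma tc_sub {F G : ℂ → ℂ} (hF : DifferentiableOn ℂ F 𝔻) (hG : DifferentiableOn ℂ G 𝔻) (n : ℕ) :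
    taylorCoeff (fun z => F z - G z) n = taylorCoeff F n - taylorCoeff G n := by
  unfold taylorCoeff
  have := iteratedDeriv_sub (cd_of_diff hF n) (cd_of_diff hG n)
  rw [show (fun z => F z - G z) = F - G from rfl, this, sub_div]

lemma tc_mul_zero {F G : ℂ → ℂ} (hF : DifferentiableOn ℂ F 𝔻) (hG : DifferentiableOn ℂ G 𝔻) (n : ℕ)
    (h : ∀ m < n, taylorCoeff G m = 0) : ∀ m < n, taylorCoeff (fun z => F z * G z) m = 0 := by
  intro m hm
  have h' : ∀ m < n, iteratedDeriv m G 0 = 0 := by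
    intro m hm
    have := h m hm
    unfold taylorCoeff at this
    rcases div_eq_zero_iff.1 this with h | h
    · exact h
    · exact absurd h (by exact_mod_cast m.factorial_ne_zero)
  unfold taylorCoeff
  have := iteratedDeriv_mul (cd_of_diff hF m) (cd_of_diff hG m)
  rw [show (fun z => F z * G z) = F * G from rfl, this, Finset.sum_eq_zero, zero_div]
  intro i _
  rw [h' (m - i) (by omega), mul_zero]

lemma tc_poly (p : Polynomial ℂ) (n : ℕ) : taylorCoeff (fun z => p.eval z) n = p.coeff n := by
  have key : ∀ n : ℕ, iteratedDeriv n (fun z => p.eval z)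
      = fun z => (Polynomial.derivative^[n] p).eval z := by
    intro n
    induction n with
    | zero => simp
    | succ k ih =>
      rw [iteratedDeriv_succ, ih]
      funext z
      rw [Polynomial.deriv, Function.iterate_succ_apply']
  unfold taylorCoeff
  rw [key]
  simp only
  rw [← Polynomial.coeff_zero_eq_eval_zero, Polynomial.coeff_iterate_derivative]
  simp [Nat.descFactorial_self]
  field_simp [Nat.factorial_ne_zero]

lemma tc_hasSum {F : ℂ → ℂ} (hF : DifferentiableOn ℂ F 𝔻) {z : ℂ} (hz : z ∈ 𝔻) :
    HasSum (fun n => taylorCoeff F n * z ^ n) (F z) := by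
  have := Complex.hasSum_taylorSeries_on_ball hF hz
  have e : (fun n => taylorCoeff F n * z ^ n)
      = fun n : ℕ => ((n.factorial : ℂ))⁻¹ • (z - 0) ^ n • iteratedDeriv n F 0 := by
    funext n
    simp only [taylorCoeff, smul_eq_mul, sub_zero]
    ring
  rw [e]
  exact this

lemma tc_bound {F : ℂ → ℂ} (hF : DifferentiableOn ℂ F 𝔻) {r M : ℝ} (hr : 0 < r) (hr1 : r < 1)
    (hM : ∀ z, ‖z‖ = r → ‖F z‖ ≤ M) (n : ℕ) : ‖taylorCoeff F n‖ ≤ M / r ^ n := by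
  have hsub : Metric.closedBall (0:ℂ) r ⊆ 𝔻 := Metric.closedBall_subset_ball hr1
  have := Complex.norm_iteratedDeriv_le_of_forall_mem_sphere_norm_le (c := 0) (C := M) (f := F) n hr
    (DifferentiableOn.diffContOnCl (by
      rw [closure_ball _ hr.ne']; exact hF.mono hsub)) (by
      intro z hz; exact hM z (by simpa using hz))
  unfold taylorCoeff
  have hn : (0:ℝ) < n.factorial := by exact_mod_cast n.factorial_pos
  rw [norm_div, Complex.norm_natCast, div_le_iff₀ hn]
  calc _ ≤ _ := this
    _ = _ := by ring

/-- truncated Taylor polynomial -/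
noncomputable def trunc (F : ℂ → ℂ) (n : ℕ) : Polynomial ℂ :=
  ∑ m ∈ Finset.range n, Polynomial.C (taylorCoeff F m) * Polynomial.X ^ m

lemma trunc_coeff (F : ℂ → ℂ) (n m : ℕ) :
    (trunc F n).coeff m = if m < n then taylorCoeff F m else 0 := by
  simp [trunc, Polynomial.finsetSum_coeff, Polynomial.coeff_X_pow]

lemma trunc_eval (F : ℂ → ℂ) (n : ℕ) (z : ℂ) :
    (trunc F n).eval z = ∑ m ∈ Finset.range n, taylorCoeff F m * z ^ m := by
  simp [trunc, Polynomial.eval_finsetSum]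

lemma poly_diff (p : Polynomial ℂ) (s : Set ℂ) : DifferentiableOn ℂ (fun z => p.eval z) s :=
  p.differentiable.differentiableOn

lemma poly_bessel (p : Polynomial ℂ) (B : ℝ) (h : ∀ z, ‖z‖ = 1 → ‖p.eval z‖ ≤ B) :
    ∀ M : ℕ, ∑ m ∈ Finset.range M, ‖p.coeff m‖ ^ 2 ≤ B ^ 2 := by
  intro M
  calc ∑ m ∈ Finset.range M, ‖p.coeff m‖ ^ 2 ≤ ∑ m ∈ p.support, ‖p.coeff m‖ ^ 2 := by
        rw [← Finset.sum_filter_add_sum_filter_not (Finset.range M) (fun m => m ∈ p.support)]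
        have : ∑ x ∈ Finset.range M with ¬ x ∈ p.support, ‖p.coeff x‖ ^ 2 = 0 := by
          apply Finset.sum_eq_zero
          intro x hx
          simp at hx
          simp [hx.2]
        rw [this, add_zero]
        apply Finset.sum_le_sum_of_subset_of_nonneg
        · intro x hx
          simp at hx ⊢
          exact hx.2
        · intros; positivity
    _ = _ := p.sum_sq_norm_coeff_eq_circleAverage
    _ ≤ B ^ 2 := by
        apply Real.circleAverage_mono_on_of_le_circle
        · apply ContinuousOn.circleIntegrable'
          fun_prop
        · intro z hz
          have : ‖z‖ = 1 := by simpa using hz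
          have := h z this
          gcongr

lemma bessel {F : ℂ → ℂ} (hF : DifferentiableOn ℂ F 𝔻) {B : ℝ} (hB : 0 ≤ B)
    (h : ∀ z ∈ 𝔻, ‖F z‖ ≤ B) (M : ℕ) :
    ∑ m ∈ Finset.range M, ‖taylorCoeff F m‖ ^ 2 ≤ B ^ 2 := by
  -- first for dilates
  have h1 : ∀ r : ℝ, 0 < r → r < 1 →
      ∑ m ∈ Finset.range M, (‖taylorCoeff F m‖ * r ^ m) ^ 2 ≤ B ^ 2 := by
    intro r hr hr1
    have hsum : Summable (fun n => ‖taylorCoeff F n‖ * r ^ n) := by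
      have := (tc_hasSum hF (z := (r:ℂ)) (by simp [abs_of_pos hr, hr1])).summable.norm
      simpa [abs_of_pos hr] using this
    have htail := tendsto_sum_nat_add (fun n => ‖taylorCoeff F n‖ * r ^ n)
    have h2 : ∀ N, M ≤ N → ∑ m ∈ Finset.range M, (‖taylorCoeff F m‖ * r ^ m) ^ 2 ≤
        (B + ∑' k, ‖taylorCoeff F (k + N)‖ * r ^ (k + N)) ^ 2 := by
      intro N hN
      set q : Polynomial ℂ := (trunc F N).comp (Polynomial.C (r:ℂ) * Polynomial.X) with hq
      have := poly_bessel q (B + ∑' k, ‖taylorCoeff F (k + N)‖ * r ^ (k + N)) ?_ M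
      · refine le_trans (le_of_eq ?_) this
        apply Finset.sum_congr rfl
        intro m hm
        rw [hq, Polynomial.comp_C_mul_X_coeff, trunc_coeff,
          if_pos (lt_of_lt_of_le (Finset.mem_range.1 hm) hN)]
        simp [abs_of_pos hr]
      · intro z hz
        have hrz : (r:ℂ) * z ∈ 𝔻 := by simp [hz, abs_of_pos hr, hr1]
        have hs := tc_hasSum hF hrz
        have e : q.eval z = F (r * z) - ∑' k, taylorCoeff F (k + N) * (r * z) ^ (k + N) := by
          rw [← hs.tsum_eq, ← hs.summable.sum_add_tsum_nat_add N, hq, Polynomial.eval_comp, trunc_eval]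
          simp
        rw [e]
        refine (norm_sub_le _ _).trans (add_le_add (h _ hrz) ?_)
        refine tsum_of_norm_bounded (((summable_nat_add_iff N).2 hsum).hasSum) ?_
        intro k
        simp [hz, abs_of_pos hr]
    have h3 : Tendsto (fun N => (B + ∑' k, ‖taylorCoeff F (k + N)‖ * r ^ (k + N)) ^ 2) atTop
        (nhds ((B + 0) ^ 2)) := (htail.const_add B).pow 2
    rw [add_zero] at h3
    exact ge_of_tendsto h3 (eventually_atTop.2 ⟨M, h2⟩)
  have h4 : Tendsto (fun r : ℝ => ∑ m ∈ Finset.range M, (‖taylorCoeff F m‖ * r ^ m) ^ 2)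
      (nhdsWithin 1 (Set.Iio 1)) (nhds (∑ m ∈ Finset.range M, (‖taylorCoeff F m‖ * 1 ^ m) ^ 2)) := by
    apply Tendsto.mono_left _ nhdsWithin_le_nhds
    apply Continuous.tendsto (f := fun r : ℝ => ∑ m ∈ Finset.range M, (‖taylorCoeff F m‖ * r ^ m) ^ 2)
    fun_prop
  simp only [one_pow, mul_one] at h4
  refine le_of_tendsto h4 ?_
  filter_upwards [Ioo_mem_nhdsLT (show (0:ℝ) < 1 by norm_num)] with r hr
  exact h1 r hr.1 hr.2

lemma weighted_bound {ω : ℕ → ℝ} (hωpos : ∀ n, 0 < ω n) (hωmono : Monotone ω)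
    {F : ℂ → ℂ} (hF : DifferentiableOn ℂ F 𝔻) {B : ℝ} (hB : 0 ≤ B)
    (h : ∀ z ∈ 𝔻, ‖F z‖ ≤ B) (n : ℕ) (h0 : ∀ m < n, taylorCoeff F m = 0) :
    MemA ω F ∧ wNormSq ω F ≤ (B / ω n) ^ 2 := by
  have key : ∀ M, ∑ m ∈ Finset.range M, ‖taylorCoeff F m‖ ^ 2 / ω m ^ 2 ≤ (B / ω n) ^ 2 := by
    intro M
    calc _ ≤ ∑ m ∈ Finset.range M, ‖taylorCoeff F m‖ ^ 2 / ω n ^ 2 := by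
          apply Finset.sum_le_sum
          intro m _
          rcases lt_or_ge m n with hm | hm
          · simp [h0 m hm]
          · have := hωmono hm
            have := hωpos n
            gcongr
      _ ≤ (B / ω n) ^ 2 := by
          rw [← Finset.sum_div, div_pow]
          have := hωpos n
          gcongr
          exact bessel hF hB h M
  have hnn : ∀ m, 0 ≤ ‖taylorCoeff F m‖ ^ 2 / ω m ^ 2 := fun m => by positivity
  exact ⟨⟨hF.analyticOnNhd Metric.isOpen_ball, summable_of_sum_range_le hnn key⟩,
    Real.tsum_le_of_sum_range_le hnn key⟩

/-- weighted norm -/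
noncomputable def wN (ω : ℕ → ℝ) (F : ℂ → ℂ) : ℝ := Real.sqrt (wNormSq ω F)

lemma MemA.diff {ω : ℕ → ℝ} {F : ℂ → ℂ} (h : MemA ω F) : DifferentiableOn ℂ F 𝔻 :=
  h.1.differentiableOn

/-- triangle inequality through the middle function `G` -/
lemma wN_triangle {ω : ℕ → ℝ} (hωpos : ∀ n, 0 < ω n) {F G K : ℂ → ℂ}
    (hF : DifferentiableOn ℂ F 𝔻) (hG : DifferentiableOn ℂ G 𝔻) (hK : DifferentiableOn ℂ K 𝔻)
    (h1 : MemA ω (fun z => F z - G z)) (h2 : MemA ω (fun z => G z - K z)) :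
    MemA ω (fun z => F z - K z) ∧
    wN ω (fun z => F z - K z) ≤ wN ω (fun z => F z - G z) + wN ω (fun z => G z - K z) := by
  set a : ℕ → ℝ := fun n => ‖taylorCoeff (fun z => F z - G z) n‖ / ω n with ha
  set b : ℕ → ℝ := fun n => ‖taylorCoeff (fun z => G z - K z) n‖ / ω n with hb
  have ha0 : ∀ n, 0 ≤ a n := fun n => div_nonneg (norm_nonneg _) (hωpos n).le
  have hb0 : ∀ n, 0 ≤ b n := fun n => div_nonneg (norm_nonneg _) (hωpos n).le
  have sa : Summable fun n => a n ^ (2:ℝ) := by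
    have := h1.2
    simpa [ha, div_pow] using this
  have sb : Summable fun n => b n ^ (2:ℝ) := by
    have := h2.2
    simpa [hb, div_pow] using this
  obtain ⟨s, hs⟩ := Real.Lp_add_le_tsum_of_nonneg (p := 2) (by norm_num) ha0 hb0 sa sb
  have hle : ∀ n, ‖taylorCoeff (fun z => F z - K z) n‖ ^ 2 / ω n ^ 2 ≤ (a n + b n) ^ (2:ℝ) := by
    intro n
    rw [Real.rpow_two, ← div_pow, ha, hb]
    have := hωpos n
    simp only
    rw [← add_div]
    gcongr
    rw [tc_sub hF hK, tc_sub hF hG, tc_sub hG hK]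
    exact norm_sub_le_norm_sub_add_norm_sub _ _ _
  have hnn : ∀ m, 0 ≤ ‖taylorCoeff (fun z => F z - K z) m‖ ^ 2 / ω m ^ 2 := fun m => by positivity
  have hsum := Summable.of_nonneg_of_le hnn hle s
  refine ⟨⟨(hF.sub hK).analyticOnNhd Metric.isOpen_ball, hsum⟩, ?_⟩
  have e1 : wN ω (fun z => F z - G z) = (∑' i, a i ^ (2:ℝ)) ^ (1 / (2:ℝ)) := by
    rw [wN, Real.sqrt_eq_rpow, wNormSq]; simp [ha, div_pow]
  have e2 : wN ω (fun z => G z - K z) = (∑' i, b i ^ (2:ℝ)) ^ (1 / (2:ℝ)) := by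
    rw [wN, Real.sqrt_eq_rpow, wNormSq]; simp [hb, div_pow]
  rw [e1, e2]
  refine le_trans ?_ hs
  rw [wN, Real.sqrt_eq_rpow, wNormSq]
  apply Real.rpow_le_rpow (tsum_nonneg hnn) (hsum.tsum_le_tsum hle s) (by norm_num)

lemma exists_log' {f : ℂ → ℂ} (hf : DifferentiableOn ℂ f 𝔻) (hfz : ∀ z ∈ 𝔻, f z ≠ 0) :
    ∃ g : ℂ → ℂ, DifferentiableOn ℂ g 𝔻 ∧ ∀ z ∈ 𝔻, f z = Complex.exp (g z) := by
  have hd : DifferentiableOn ℂ (fun z => deriv f z / f z) 𝔻 :=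
    (hf.deriv Metric.isOpen_ball).div hf hfz
  obtain ⟨g, hg0, hg⟩ := hd.isExactOn_ball.with_val_at 0 (Complex.log (f 0))
  have hgd : DifferentiableOn ℂ g 𝔻 := fun z hz => (hg z hz).differentiableAt.differentiableWithinAt
  refine ⟨g, hgd, ?_⟩
  have hder : ∀ z ∈ 𝔻, HasDerivAt (fun z => f z * Complex.exp (-g z)) 0 z := by
    intro z hz
    have h1 : HasDerivAt f (deriv f z) z :=
      (hf.differentiableAt (Metric.isOpen_ball.mem_nhds hz)).hasDerivAt
    have h2 := h1.mul ((hg z hz).neg.cexp)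
    refine h2.congr_deriv ?_
    have := hfz z hz
    change deriv f z * Complex.exp (-g z) + f z * (Complex.exp (-g z) * -(deriv f z / f z)) = 0
    field_simp
    ring
  intro z hz
  have hc := Metric.isOpen_ball.is_const_of_deriv_eq_zero (s := 𝔻)
    (f := fun z => f z * Complex.exp (-g z)) (convex_ball (0:ℂ) 1).isPreconnected
    (fun z hz => (hder z hz).differentiableAt.differentiableWithinAt)
    (fun z hz => (hder z hz).deriv) hz (show (0:ℂ) ∈ 𝔻 by simp)
  simp only [hg0] at hc
  rw [Complex.exp_neg, Complex.exp_neg, Complex.exp_log (hfz 0 (by simp)),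
    mul_inv_cancel₀ (hfz 0 (by simp))] at hc
  have := Complex.exp_ne_zero (g z)
  field_simp at hc
  exact hc

lemma exists_rep {f : ℂ → ℂ} (hf : DifferentiableOn ℂ f 𝔻) (hfz : ∀ z ∈ 𝔻, f z ≠ 0)
    (hfb : ∃ C : ℝ, ∀ z ∈ 𝔻, ‖f z‖ ≤ C) :
    ∃ C : ℝ, 0 < C ∧ ∃ h : ℂ → ℂ, DifferentiableOn ℂ h 𝔻 ∧ (∀ z ∈ 𝔻, 0 ≤ (h z).re) ∧
      (∀ z ∈ 𝔻, f z = C * Complex.exp (-h z)) ∧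
      ∃ H : ℝ, 0 < H ∧ ∀ z ∈ 𝔻, ‖h z‖ ≤ H / (1 - ‖z‖) := by
  obtain ⟨C, hC⟩ := hfb
  have h0 : (0:ℂ) ∈ 𝔻 := by simp
  have hCpos : 0 < C := lt_of_lt_of_le (norm_pos_iff.2 (hfz 0 h0)) (hC 0 h0)
  obtain ⟨g, hg, hfg⟩ := exists_log' hf hfz
  have hre : ∀ z ∈ 𝔻, (g z).re ≤ Real.log C := by
    intro z hz
    have := hC z hz
    rw [hfg z hz, Complex.norm_exp] at this
    exact (Real.le_log_iff_exp_le hCpos).2 this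
  refine ⟨C, hCpos, fun z => (Real.log C : ℂ) - g z, ?_, ?_, ?_, ?_⟩
  · exact hg.const_sub _
  · intro z hz
    have := hre z hz
    simp only [Complex.sub_re, Complex.ofReal_re]
    linarith
  · intro z hz
    rw [hfg z hz, neg_sub, Complex.exp_sub, ← Complex.ofReal_exp, Real.exp_log hCpos]
    have : (C:ℂ) ≠ 0 := by exact_mod_cast hCpos.ne'
    field_simp
  · set k : ℂ → ℂ := fun z => g z - (Real.log C : ℂ) with hk
    have hkd : DifferentiableOn ℂ k 𝔻 := hg.sub_const _
    refine ⟨2 + 2 * ‖k 0‖, by positivity, ?_⟩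
    intro z hz
    have hz1 : ‖z‖ < 1 := by simpa using hz
    have := Complex.borelCaratheodory (M := 1) one_pos hkd (by
      intro w hw
      have := hre w hw
      simp only [hk, Set.mem_ofPred_eq, Complex.sub_re, Complex.ofReal_re]
      linarith) one_pos hz
    rw [norm_sub_rev]
    refine this.trans ?_
    rw [← add_div]
    have hp : 0 < 1 - ‖z‖ := by linarith
    gcongr ?_ / _
    nlinarith [norm_nonneg (k 0), norm_nonneg z]

lemma step_lemma {ω : ℕ → ℝ} (hωpos : ∀ n, 0 < ω n) (hωmono : Monotone ω)
    {h : ℂ → ℂ} (hh : DifferentiableOn ℂ h 𝔻) (hre : ∀ z ∈ 𝔻, 0 ≤ (h z).re)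
    {H : ℝ} (hH : 0 < H) (hHb : ∀ z ∈ 𝔻, ‖h z‖ ≤ H / (1 - ‖z‖))
    {n : ℕ} (hn : 1 ≤ n) (hℓ : 0 < Real.log (ω n)) (hℓn : Real.log (ω n) ≤ n)
    (hgood : (n:ℝ) ≤ Real.exp (Real.log (ω n) / 16))
    {t s : ℝ} (ht : 0 ≤ t) (hs : 0 ≤ s) (ht1 : t ≤ Real.log (ω n) ^ 2 / (256 * H * n))
    (q : Polynomial ℂ) {B : ℝ} (hB : 0 ≤ B) (hq : ∀ z ∈ 𝔻, ‖q.eval z‖ ≤ B) :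
    ∃ g : Polynomial ℂ, (∀ z ∈ 𝔻, ‖g.eval z‖ ≤ Real.exp (Real.log (ω n) / 4)) ∧
      MemA ω (fun z => q.eval z * Complex.exp (-(s * h z))
        - (q * g).eval z * Complex.exp (-((s + t : ℝ) * h z))) ∧
      wN ω (fun z => q.eval z * Complex.exp (-(s * h z))
        - (q * g).eval z * Complex.exp (-((s + t : ℝ) * h z)))
        ≤ 2 * B * Real.exp (-(3 * Real.log (ω n) / 4)) := by
  set ℓ := Real.log (ω n) with hℓdef
  have hn0 : (0:ℝ) < n := by exact_mod_cast hn
  have hωe : ω n = Real.exp ℓ := (Real.exp_log (hωpos n)).symm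
  set v : ℂ → ℂ := fun z => Complex.exp (t * h z) with hv
  have hvd : DifferentiableOn ℂ v 𝔻 := (hh.const_mul _).cexp
  set δ := ℓ / (16 * n) with hδ
  have hδ0 : 0 < δ := by positivity
  have hδ1 : δ ≤ 1 / 16 := by
    rw [hδ, div_le_div_iff₀ (by positivity) (by norm_num)]; linarith
  have hcoef : ∀ m < n, ‖taylorCoeff v m‖ ≤ Real.exp (ℓ / 8 + ℓ / 16) := by
    intro m hm
    have hb := tc_bound hvd (r := 1 - δ) (M := Real.exp (ℓ / 16)) (by linarith) (by linarith) (by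
      intro z hz
      have hz1 : z ∈ 𝔻 := by simp [hz]; linarith
      rw [hv]
      simp only
      rw [Complex.norm_exp]
      apply Real.exp_le_exp.2
      have h1 := hHb z hz1
      rw [hz] at h1
      have h2 : (t * h z : ℂ).re ≤ t * ‖h z‖ := by
        rw [Complex.re_ofReal_mul]
        exact mul_le_mul_of_nonneg_left (Complex.re_le_norm _) ht
      refine h2.trans ?_
      calc t * ‖h z‖ ≤ (ℓ ^ 2 / (256 * H * n)) * (H / (1 - (1 - δ))) := by gcongr
        _ = ℓ / 16 := by
          rw [sub_sub_cancel, hδ]; field_simp; norm_num) m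
    refine hb.trans ?_
    rw [div_le_iff₀ (by apply pow_pos; linarith)]
    have h3 : Real.exp (-(2 * δ)) ≤ 1 - δ := by
      have h4 : 1 + 2 * δ ≤ Real.exp (2 * δ) := by
        have := Real.add_one_le_exp (2 * δ); linarith
      rw [Real.exp_neg, inv_le_comm₀ (by positivity) (by linarith)]
      refine le_trans ?_ h4
      rw [inv_le_iff_one_le_mul₀ (by linarith)]
      nlinarith
    have h5 : Real.exp (-(ℓ / 8)) ≤ (1 - δ) ^ m := by
      calc Real.exp (-(ℓ / 8)) = Real.exp (-(2 * δ)) ^ n := by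
            rw [← Real.exp_nat_mul]; congr 1; rw [hδ]; field_simp; norm_num
        _ ≤ (1 - δ) ^ n := by gcongr
        _ ≤ (1 - δ) ^ m := pow_le_pow_of_le_one (by linarith) (by linarith) hm.le
    calc Real.exp (ℓ / 16) = Real.exp (ℓ / 8 + ℓ / 16) * Real.exp (-(ℓ / 8)) := by
          rw [← Real.exp_add]; congr 1; ring
      _ ≤ _ := by gcongr
  set g := trunc v n with hg
  have hgb : ∀ z ∈ 𝔻, ‖g.eval z‖ ≤ Real.exp (ℓ / 4) := by
    intro z hz
    have hz1 : ‖z‖ ≤ 1 := by have : ‖z‖ < 1 := by simpa using hz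
                             exact this.le
    rw [hg, trunc_eval]
    calc _ ≤ ∑ m ∈ Finset.range n, Real.exp (ℓ / 8 + ℓ / 16) := by
          refine norm_sum_le_of_le _ ?_
          intro m hm
          rw [norm_mul, norm_pow]
          calc _ ≤ Real.exp (ℓ / 8 + ℓ / 16) * 1 :=
                mul_le_mul (hcoef m (Finset.mem_range.1 hm)) (pow_le_one₀ (norm_nonneg _) hz1)
                  (by positivity) (by positivity)
            _ = _ := mul_one _
      _ = n * Real.exp (ℓ / 8 + ℓ / 16) := by simp
      _ ≤ Real.exp (ℓ / 16) * Real.exp (ℓ / 8 + ℓ / 16) := by gcongr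
      _ = Real.exp (ℓ / 4) := by rw [← Real.exp_add]; congr 1; ring
  refine ⟨g, hgb, ?_⟩
  set F : ℂ → ℂ := fun z => q.eval z * Complex.exp (-(s * h z))
        - (q * g).eval z * Complex.exp (-((s + t : ℝ) * h z)) with hF
  have hFeq : F = fun z => (q.eval z * Complex.exp (-((s + t : ℝ) * h z))) * (v z - g.eval z) := by
    funext z
    have : Complex.exp (-(s * h z)) = Complex.exp (-((s + t : ℝ) * h z)) * v z := by
      rw [hv]; simp only; rw [← Complex.exp_add]; congr 1; push_cast; ring
    rw [hF]; simp only [this, Polynomial.eval_mul]; ring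
  have hvg : DifferentiableOn ℂ (fun z => v z - g.eval z) 𝔻 := hvd.sub (poly_diff g _)
  have hA : DifferentiableOn ℂ (fun z => q.eval z * Complex.exp (-((s + t : ℝ) * h z))) 𝔻 :=
    (poly_diff q _).mul ((hh.const_mul _).neg.cexp)
  have hzero : ∀ m < n, taylorCoeff F m = 0 := by
    rw [hFeq]
    refine tc_mul_zero hA hvg n ?_
    intro m hm
    rw [tc_sub hvd (poly_diff g _), tc_poly, hg, trunc_coeff, if_pos hm, sub_self]
  have hFd : DifferentiableOn ℂ F 𝔻 := by rw [hFeq]; exact hA.mul hvg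
  have hu : ∀ a : ℝ, 0 ≤ a → ∀ z ∈ 𝔻, ‖Complex.exp (-(a * h z))‖ ≤ 1 := by
    intro a ha z hz
    rw [Complex.norm_exp, Real.exp_le_one_iff, Complex.neg_re, Complex.re_ofReal_mul]
    have := mul_nonneg ha (hre z hz)
    linarith
  have hFb : ∀ z ∈ 𝔻, ‖F z‖ ≤ 2 * B * Real.exp (ℓ / 4) := by
    intro z hz
    have e1 : (1:ℝ) ≤ Real.exp (ℓ / 4) := Real.one_le_exp (by positivity)
    refine (norm_sub_le _ _).trans ?_
    rw [norm_mul, norm_mul, Polynomial.eval_mul, norm_mul]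
    have a1 : ‖q.eval z‖ * ‖Complex.exp (-(s * h z))‖ ≤ B * 1 :=
      mul_le_mul (hq z hz) (hu s hs z hz) (norm_nonneg _) hB
    have a2 : ‖q.eval z‖ * ‖g.eval z‖ * ‖Complex.exp (-((s + t : ℝ) * h z))‖
        ≤ (B * Real.exp (ℓ / 4)) * 1 :=
      mul_le_mul (mul_le_mul (hq z hz) (hgb z hz) (norm_nonneg _) hB)
        (hu (s + t) (by positivity) z hz) (norm_nonneg _) (by positivity)
    nlinarith
  obtain ⟨m1, m2⟩ := weighted_bound hωpos hωmono hFd (by positivity) hFb n hzero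
  refine ⟨m1, ?_⟩
  rw [wN]
  refine Real.sqrt_le_iff.2 ⟨by positivity, m2.trans (le_of_eq ?_)⟩
  congr 1
  rw [hωe, mul_div_assoc, ← Real.exp_sub]
  congr 2
  ring

lemma iterate_lemma {ω : ℕ → ℝ} (hωpos : ∀ n, 0 < ω n) (hωmono : Monotone ω)
    {h : ℂ → ℂ} (hh : DifferentiableOn ℂ h 𝔻) (hre : ∀ z ∈ 𝔻, 0 ≤ (h z).re)
    {H : ℝ} (hH : 0 < H) (hHb : ∀ z ∈ 𝔻, ‖h z‖ ≤ H / (1 - ‖z‖))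
    (N : ℕ → ℕ) (hN : ∀ k, 1 ≤ N k ∧ 2 ≤ Real.log (ω (N k)) ∧ Real.log (ω (N k)) ≤ N k ∧
      (N k : ℝ) ≤ Real.exp (Real.log (ω (N k)) / 16))
    (hN2 : ∀ k, 2 * Real.log (ω (N k)) ≤ Real.log (ω (N (k + 1))))
    (q : Polynomial ℂ) {B : ℝ} (hB : 0 ≤ B) (hq : ∀ z ∈ 𝔻, ‖q.eval z‖ ≤ B) (K : ℕ) :
    ∃ p : Polynomial ℂ, (∀ z ∈ 𝔻, ‖p.eval z‖ ≤ B * Real.exp (Real.log (ω (N K)) / 4)) ∧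
      MemA ω (fun z => q.eval z - p.eval z * Complex.exp (-((min 1
        (∑ k ∈ Finset.range K, Real.log (ω (N k)) ^ 2 / (256 * H * N k)) : ℝ) * h z))) ∧
      wN ω (fun z => q.eval z - p.eval z * Complex.exp (-((min 1
        (∑ k ∈ Finset.range K, Real.log (ω (N k)) ^ 2 / (256 * H * N k)) : ℝ) * h z)))
        ≤ 4 * B * (Real.exp (-(Real.log (ω (N 0)) / 2)) - Real.exp (-(Real.log (ω (N K)) / 2))) := by
  induction K with
  | zero =>
    refine ⟨q, ?_, ?_⟩
    · intro z hz
      have e1 : (1:ℝ) ≤ Real.exp (Real.log (ω (N 0)) / 4) :=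
        Real.one_le_exp (by have := (hN 0).2.1; linarith)
      nlinarith [hq z hz]
    · obtain ⟨m1, m2⟩ := weighted_bound hωpos hωmono (F := fun _ => 0) (B := 0)
        (differentiableOn_const 0) le_rfl (by simp) 0 (by simp)
      simp only [Finset.range_zero, Finset.sum_empty, sub_self, mul_zero]
      rw [min_eq_right zero_le_one]
      simp only [Complex.ofReal_zero, zero_mul, neg_zero, Complex.exp_zero, mul_one, sub_self]
      refine ⟨m1, ?_⟩
      rw [wN]
      exact Real.sqrt_le_iff.2 ⟨le_rfl, m2.trans (by simp)⟩
  | succ K ih =>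
    obtain ⟨p, hp, hpm, hpw⟩ := ih
    obtain ⟨n1, n2, n3, n4⟩ := hN K
    rw [Finset.sum_range_succ]
    set S := ∑ k ∈ Finset.range K, Real.log (ω (N k)) ^ 2 / (256 * H * N k) with hS
    set τ := Real.log (ω (N K)) ^ 2 / (256 * H * N K) with hτ
    set ℓ := Real.log (ω (N K)) with hℓ
    have hS0 : 0 ≤ S := Finset.sum_nonneg (fun k _ => by positivity)
    have hτ0 : 0 ≤ τ := by positivity
    obtain ⟨g, hg, hgm, hgw⟩ := step_lemma hωpos hωmono hh hre hH hHb n1 (by linarith) n3 n4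
      (t := min 1 (S + τ) - min 1 S) (s := min 1 S)
      (by rw [sub_nonneg]; exact min_le_min le_rfl (by linarith)) (by positivity)
      (by
        rw [sub_le_iff_le_add, ← hℓ, ← hτ]
        rcases le_total 1 S with h1 | h1
        · rw [min_eq_left h1]; linarith [min_le_left 1 (S + τ)]
        · rw [min_eq_right h1]; linarith [min_le_right 1 (S + τ)])
      p (by positivity) hp
    rw [← hℓ] at hg hgw
    rw [add_sub_cancel] at hgm hgw
    obtain ⟨t1, t2⟩ := wN_triangle hωpos (poly_diff q _)
      ((poly_diff p _).mul ((hh.const_mul _).neg.cexp))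
      ((poly_diff (p * g) _).mul ((hh.const_mul _).neg.cexp)) hpm hgm
    refine ⟨p * g, ?_, t1, t2.trans ?_⟩
    · intro z hz
      rw [Polynomial.eval_mul, norm_mul]
      calc _ ≤ (B * Real.exp (ℓ / 4)) * Real.exp (ℓ / 4) :=
            mul_le_mul (hp z hz) (hg z hz) (norm_nonneg _) (by positivity)
        _ = B * Real.exp (2 * ℓ / 4) := by
            rw [mul_assoc, ← Real.exp_add]; congr 2; ring
        _ ≤ _ := by
            have := hN2 K
            gcongr
    · refine (add_le_add hpw hgw).trans ?_
      have e1 : 2 * (B * Real.exp (ℓ / 4)) * Real.exp (-(3 * ℓ / 4)) =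
          2 * B * Real.exp (-(ℓ / 2)) := by
        rw [show -(ℓ / 2) = ℓ / 4 + -(3 * ℓ / 4) by ring, Real.exp_add]; ring
      rw [e1]
      have e2 : Real.exp (-(Real.log (ω (N (K + 1))) / 2)) ≤ Real.exp (-(ℓ / 2)) / 2 := by
        have h1 : Real.exp (-(Real.log (ω (N (K + 1))) / 2)) ≤ Real.exp (-(ℓ / 2) + -(ℓ / 2)) := by
          apply Real.exp_le_exp.2
          have := hN2 K
          linarith
        have h2 : Real.exp (-(ℓ / 2)) ≤ 1 / 2 := by
          have h3 : (2:ℝ) ≤ Real.exp (ℓ / 2) := by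
            have := Real.add_one_le_exp (ℓ / 2); linarith
          rw [Real.exp_neg, one_div]
          exact inv_anti₀ (by norm_num) h3
        rw [Real.exp_add] at h1
        have := Real.exp_pos (-(ℓ / 2))
        nlinarith
      nlinarith

lemma bad_summable : Summable (fun n : ℕ => (16 * Real.log n) ^ 2 / (n:ℝ) ^ 2) := by
  have h1 : Summable (fun n : ℕ => 4096 * (1 / (n:ℝ) ^ (3/2 : ℝ))) :=
    (Real.summable_one_div_nat_rpow.2 (by norm_num)).mul_left _
  refine Summable.of_nonneg_of_le (fun n => by positivity) ?_ h1
  intro n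
  rcases Nat.eq_zero_or_pos n with rfl | hn
  · simp
  have hn0 : (0:ℝ) < n := by exact_mod_cast hn
  have hl0 : 0 ≤ Real.log n := Real.log_natCast_nonneg n
  have hl : Real.log n ≤ 4 * (n:ℝ) ^ (1/4 : ℝ) := by
    have := Real.log_le_rpow_div hn0.le (show (0:ℝ) < 1/4 by norm_num)
    linarith
  have e : ((n:ℝ) ^ (1/4 : ℝ)) ^ 2 * (n:ℝ) ^ (3/2 : ℝ) = (n:ℝ) ^ 2 := by
    rw [← Real.rpow_natCast, ← Real.rpow_mul hn0.le, ← Real.rpow_add hn0, ← Real.rpow_natCast]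
    norm_num
  rw [mul_one_div, div_le_div_iff₀ (by positivity) (by positivity), ← e]
  have : (16 * Real.log n) ^ 2 ≤ 4096 * ((n:ℝ) ^ (1/4 : ℝ)) ^ 2 := by
    have : (16 * Real.log n) ^ 2 ≤ (16 * (4 * (n:ℝ) ^ (1/4 : ℝ))) ^ 2 := by gcongr
    linarith
  calc _ ≤ 4096 * ((n:ℝ) ^ (1/4 : ℝ)) ^ 2 * (n:ℝ) ^ (3/2 : ℝ) := by gcongr
    _ = _ := by ring

lemma sum_Ico_sq (n m : ℕ) (hn : 1 ≤ n) : ∑ i ∈ Finset.Ico n m, ((i:ℝ) ^ 2)⁻¹ ≤ 2 / n := by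
  have := sum_Ioo_inv_sq_le (α := ℝ) (n - 1) m
  have e : Finset.Ioo (n - 1) m = Finset.Ico n m := by
    ext i; simp only [Finset.mem_Ioo, Finset.mem_Ico]; omega
  rw [e] at this
  have e2 : (((n - 1 : ℕ) : ℝ) + 1) = n := by
    rw [Nat.cast_sub hn]; simp
  rwa [e2] at this

lemma seq_lemma {ω : ℕ → ℝ}
    (hωtop : Tendsto ω atTop atTop)
    (hωo : (fun n : ℕ => Real.log (ω n)) =o[atTop] (fun n : ℕ => (n : ℝ)))
    (hdiv : ¬ Summable (fun n : ℕ => Real.log (ω n) ^ 2 / (n : ℝ) ^ 2)) (L T : ℝ) :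
    ∃ N : ℕ → ℕ, (∀ k, 1 ≤ N k ∧ 2 ≤ Real.log (ω (N k)) ∧ Real.log (ω (N k)) ≤ N k ∧
      (N k : ℝ) ≤ Real.exp (Real.log (ω (N k)) / 16)) ∧ L ≤ Real.log (ω (N 0)) ∧
      (∀ k, 2 * Real.log (ω (N k)) ≤ Real.log (ω (N (k + 1)))) ∧
      ∃ K, T ≤ ∑ k ∈ Finset.range K, Real.log (ω (N k)) ^ 2 / N k := by
  set ℓ : ℕ → ℝ := fun n => Real.log (ω n) with hℓ
  have hℓtop : Tendsto ℓ atTop atTop := Real.tendsto_log_atTop.comp hωtop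
  obtain ⟨M0, hM0⟩ := eventually_atTop.1 (((eventually_ge_atTop 1).and
    (hℓtop.eventually_ge_atTop (max L 2))).and (hωo.bound one_pos))
  have hM1 : ∀ n, M0 ≤ n → 1 ≤ n ∧ L ≤ ℓ n ∧ 2 ≤ ℓ n ∧ ℓ n ≤ n := by
    intro n hn
    obtain ⟨⟨a, b⟩, c⟩ := hM0 n hn
    refine ⟨a, (le_max_left _ _).trans b, (le_max_right _ _).trans b, ?_⟩
    rw [one_mul, Real.norm_natCast] at c
    exact (Real.le_norm_self _).trans c
  let good : ℕ → Prop := fun n => (n:ℝ) ≤ Real.exp (ℓ n / 16)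
  classical
  set b : ℕ → ℝ := fun n => if good n then ℓ n ^ 2 / (n:ℝ) ^ 2 else 0 with hb
  have hb0 : ∀ n, 0 ≤ b n := by
    intro n; rw [hb]; simp only; split_ifs <;> positivity
  have hbns : ¬ Summable b := by
    intro hsb
    apply hdiv
    have hs2 := hsb.add bad_summable
    refine Summable.of_norm_bounded_eventually_nat hs2 ?_
    filter_upwards [eventually_ge_atTop M0] with n hn
    obtain ⟨a1, a2, a3, a4⟩ := hM1 n hn
    have hn0 : (0:ℝ) < n := by exact_mod_cast a1
    rw [Real.norm_of_nonneg (by positivity)]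
    by_cases hg : good n
    · have : b n = ℓ n ^ 2 / (n:ℝ) ^ 2 := if_pos hg
      rw [this]
      have : 0 ≤ (16 * Real.log n) ^ 2 / (n:ℝ) ^ 2 := by positivity
      linarith
    · have : b n = 0 := if_neg hg
      rw [this, zero_add]
      have h1 : ℓ n / 16 < Real.log n := (Real.lt_log_iff_exp_lt hn0).2 (not_le.1 hg)
      change ℓ n ^ 2 / (n:ℝ) ^ 2 ≤ _
      gcongr
      linarith
  have hfreq : ∀ M, ∃ m, M ≤ m ∧ good m := by
    intro M
    by_contra! hcon
    apply hbns
    apply summable_of_ne_finset_zero (s := Finset.range M)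
    intro m hm
    exact if_neg (hcon m (by simpa using hm))
  have hnext : ∀ n, ∃ m, n < m ∧ good m ∧ 2 * ℓ n ≤ ℓ m := by
    intro n
    obtain ⟨M, hM⟩ := eventually_atTop.1 (hℓtop.eventually_ge_atTop (2 * ℓ n))
    obtain ⟨m, hm, hg⟩ := hfreq (max M (n + 1))
    exact ⟨m, by have := le_max_right M (n+1); omega, hg, hM m ((le_max_left _ _).trans hm)⟩
  have hnext' : ∀ n, ∃ m, (n < m ∧ good m ∧ 2 * ℓ n ≤ ℓ m) ∧
      ∀ k < m, ¬ (n < k ∧ good k ∧ 2 * ℓ n ≤ ℓ k) := by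
    intro n
    have hex := hnext n
    exact ⟨Nat.find hex, Nat.find_spec hex, fun k hk => Nat.find_min hex hk⟩
  choose nx hnx1 hnx2 using hnext'
  obtain ⟨n0, hn0, hgn0⟩ := hfreq M0
  obtain ⟨N, hN0, hNs⟩ : ∃ N : ℕ → ℕ, N 0 = n0 ∧ ∀ k, N (k + 1) = nx (N k) :=
    ⟨fun k => Nat.rec n0 (fun _ n => nx n) k, rfl, fun _ => rfl⟩
  have hspec : ∀ k, N k < N (k + 1) ∧ good (N (k + 1)) ∧ 2 * ℓ (N k) ≤ ℓ (N (k + 1)) := by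
    intro k; rw [hNs]; exact hnx1 (N k)
  have hfmin : ∀ k m, m < N (k + 1) → ¬ (N k < m ∧ good m ∧ 2 * ℓ (N k) ≤ ℓ m) :=
    fun k m hm => hnx2 (N k) m (by rw [← hNs]; exact hm)
  have hNmono : StrictMono N := strictMono_nat_of_lt_succ (fun k => (hspec k).1)
  have hNge : ∀ k, M0 ≤ N k := fun k => hn0.trans (by rw [← hN0]; exact hNmono.monotone (Nat.zero_le k))
  have hNgood : ∀ k, good (N k) := by
    intro k
    cases k with
    | zero => rw [hN0]; exact hgn0
    | succ k => exact (hspec k).2.1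
  refine ⟨N, ?_, (hM1 _ (hNge 0)).2.1, fun k => (hspec k).2.2, ?_⟩
  · intro k
    obtain ⟨a1, a2, a3, a4⟩ := hM1 _ (hNge k)
    exact ⟨a1, a3, a4, hNgood k⟩
  have hblock : ∀ k, ∑ m ∈ Finset.Ico (N k) (N (k + 1)), b m ≤ 8 * (ℓ (N k) ^ 2 / N k) := by
    intro k
    obtain ⟨a1, a2, a3, a4⟩ := hM1 _ (hNge k)
    have hpos : (0:ℝ) < N k := by exact_mod_cast a1
    calc _ ≤ ∑ m ∈ Finset.Ico (N k) (N (k + 1)), 4 * ℓ (N k) ^ 2 * ((m:ℝ) ^ 2)⁻¹ := by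
          apply Finset.sum_le_sum
          intro m hm
          rw [Finset.mem_Ico] at hm
          by_cases hg : good m
          · have hbm : b m = ℓ m ^ 2 / (m:ℝ) ^ 2 := if_pos hg
            rw [hbm, div_eq_mul_inv]
            obtain ⟨c1, c2, c3, c4⟩ := hM1 m ((hNge k).trans hm.1)
            have hlt : ℓ m ≤ 2 * ℓ (N k) := by
              rcases hm.1.eq_or_lt with he | hlt
              · rw [← he]; linarith
              · have := hfmin k m hm.2
                by_contra hc
                exact this ⟨hlt, hg, (not_le.1 hc).le⟩
            have : ℓ m ^ 2 ≤ 4 * ℓ (N k) ^ 2 := by nlinarith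
            gcongr
          · have hbm : b m = 0 := if_neg hg
            rw [hbm]; positivity
      _ = 4 * ℓ (N k) ^ 2 * ∑ m ∈ Finset.Ico (N k) (N (k + 1)), ((m:ℝ) ^ 2)⁻¹ := by
          rw [Finset.mul_sum]
      _ ≤ 4 * ℓ (N k) ^ 2 * (2 / N k) := by
          gcongr
          exact sum_Ico_sq _ _ a1
      _ = _ := by ring
  have hall : ∀ K, ∑ m ∈ Finset.range (N K), b m ≤
      ∑ m ∈ Finset.range (N 0), b m + 8 * ∑ k ∈ Finset.range K, ℓ (N k) ^ 2 / N k := by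
    intro K
    induction K with
    | zero => simp
    | succ K ih =>
      rw [← Finset.sum_range_add_sum_Ico b (hspec K).1.le, Finset.sum_range_succ]
      have := hblock K
      linarith
  have htop := (not_summable_iff_tendsto_nat_atTop_of_nonneg hb0).1 hbns
  obtain ⟨K, hK⟩ := (htop.eventually_ge_atTop (∑ m ∈ Finset.range (N 0), b m + 8 * T)).exists
  refine ⟨K, ?_⟩
  have h1 : ∑ m ∈ Finset.range K, b m ≤ ∑ m ∈ Finset.range (N K), b m :=
    Finset.sum_le_sum_of_subset_of_nonneg (Finset.range_subset_range.2 hNmono.le_apply)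
      (fun _ _ _ => hb0 _)
  have := hall K
  change T ≤ ∑ k ∈ Finset.range K, ℓ (N k) ^ 2 / N k
  linarith

lemma tc_congr {F G : ℂ → ℂ} (h : ∀ z ∈ 𝔻, F z = G z) :
    (∀ n, taylorCoeff F n = taylorCoeff G n) := by
  intro n
  unfold taylorCoeff
  congr 1
  have : F =ᶠ[nhds 0] G := by
    filter_upwards [Metric.isOpen_ball.mem_nhds (show (0:ℂ) ∈ 𝔻 by simp)] with z hz
    exact h z hz
  exact this.iteratedDeriv_eq n

lemma trunc_approx {ω : ℕ → ℝ} {g : ℂ → ℂ} (hg : MemA ω g) {ε : ℝ} (hε : 0 < ε) :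
    ∃ q : Polynomial ℂ, MemA ω (fun z => q.eval z - g z) ∧ wN ω (fun z => q.eval z - g z) < ε := by
  have htail := tendsto_sum_nat_add (fun n => ‖taylorCoeff g n‖ ^ 2 / ω n ^ 2)
  obtain ⟨N, hN⟩ := (htail.eventually_lt_const (show (0:ℝ) < ε ^ 2 by positivity)).exists
  have e : ∀ n, ‖taylorCoeff (fun z => (trunc g N).eval z - g z) n‖ ^ 2 / ω n ^ 2 =
      if n < N then 0 else ‖taylorCoeff g n‖ ^ 2 / ω n ^ 2 := by
    intro n
    rw [tc_sub (poly_diff _ _) hg.diff, tc_poly, trunc_coeff]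
    split_ifs <;> simp
  have hs : Summable (fun n => ‖taylorCoeff (fun z => (trunc g N).eval z - g z) n‖ ^ 2 / ω n ^ 2) := by
    refine Summable.of_nonneg_of_le (fun n => by positivity) ?_ hg.2
    intro n
    rw [e]
    split_ifs
    · positivity
    · exact le_rfl
  refine ⟨trunc g N, ⟨((poly_diff _ _).sub hg.diff).analyticOnNhd Metric.isOpen_ball, hs⟩, ?_⟩
  rw [wN, Real.sqrt_lt' hε, wNormSq, ← hs.sum_add_tsum_nat_add N]
  have z1 : ∑ i ∈ Finset.range N, ‖taylorCoeff (fun z => (trunc g N).eval z - g z) i‖ ^ 2 / ω i ^ 2 = 0 := by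
    apply Finset.sum_eq_zero
    intro i hi
    rw [e, if_pos (Finset.mem_range.1 hi)]
  rw [z1, zero_add]
  refine lt_of_eq_of_lt ?_ hN
  congr 1
  funext k
  rw [e, if_neg (by omega)]

/-- **Theorem 1.** If `ω` is a weight sequence with
`∑ (log ω n)² / n² = ∞`, then every bounded zero-free analytic
function on the unit disk is cyclic in `A²_ω`. -/
theorem cyclicity_of_zero_free_Hinf
    (ω : ℕ → ℝ) (hωpos : ∀ n, 0 < ω n) (hωmono : Monotone ω)
    (hωtop : Tendsto ω atTop atTop)
    (hωo : (fun n : ℕ => Real.log (ω n)) =o[atTop] (fun n : ℕ => (n : ℝ)))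
    (hdiv : ¬ Summable (fun n : ℕ => Real.log (ω n) ^ 2 / (n : ℝ) ^ 2))
    (f : ℂ → ℂ) (hf : AnalyticOnNhd ℂ f (Metric.ball (0 : ℂ) 1))
    (hfb : ∃ C : ℝ, ∀ z ∈ Metric.ball (0 : ℂ) 1, ‖f z‖ ≤ C)
    (hfz : ∀ z ∈ Metric.ball (0 : ℂ) 1, f z ≠ 0) :
    CyclicA ω f := by

  have hfd : DifferentiableOn ℂ f 𝔻 := hf.differentiableOn
  obtain ⟨C, hC, h, hh, hre, hfh, H, hH, hHb⟩ := exists_rep hfd hfz hfb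
  refine ⟨?_, ?_⟩
  · obtain ⟨C2, hC2⟩ := hfb
    have : 0 ≤ C2 := (norm_nonneg _).trans (hC2 0 (by simp))
    exact (weighted_bound hωpos hωmono hfd this hC2 0 (by simp)).1
  intro g hg ε hε
  obtain ⟨q, hqm, hqw⟩ := trunc_approx hg (half_pos hε)
  obtain ⟨B, hB0, hB⟩ : ∃ B : ℝ, 0 < B ∧ ∀ z ∈ 𝔻, ‖q.eval z‖ ≤ B := by
    obtain ⟨B, hB⟩ := (isCompact_closedBall (0:ℂ) 1).exists_bound_of_continuousOn
      (f := fun z => q.eval z) q.continuous.continuousOn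
    refine ⟨max B 1, by positivity, fun z hz => (hB z (Metric.ball_subset_closedBall hz)).trans
      (le_max_left _ _)⟩
  -- choose the starting level
  have hlim : Tendsto (fun x : ℝ => 4 * B * Real.exp (-(x / 2))) atTop (nhds (4 * B * 0)) := by
    apply Tendsto.const_mul
    exact Real.tendsto_exp_neg_atTop_nhds_zero.comp (tendsto_id.atTop_div_const (by norm_num))
  rw [mul_zero] at hlim
  obtain ⟨L, hL⟩ := (hlim.eventually_lt_const (half_pos hε)).exists
  obtain ⟨N, hN, hNL, hN2, K, hK⟩ := seq_lemma hωtop hωo hdiv L (256 * H)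
  obtain ⟨p, -, hpm, hpw⟩ := iterate_lemma hωpos hωmono hh hre hH hHb N hN hN2 q hB0.le hB K
  have hmin : min 1 (∑ k ∈ Finset.range K, Real.log (ω (N k)) ^ 2 / (256 * H * N k)) = 1 := by
    apply min_eq_left
    have e : ∑ k ∈ Finset.range K, Real.log (ω (N k)) ^ 2 / (256 * H * N k)
        = (∑ k ∈ Finset.range K, Real.log (ω (N k)) ^ 2 / N k) / (256 * H) := by
      rw [Finset.sum_div]
      apply Finset.sum_congr rfl
      intro k _
      rw [div_div]; congr 1; ring
    rw [e, le_div_iff₀ (by positivity), one_mul]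
    exact hK
  rw [hmin] at hpm hpw
  have hpw2 : wN ω (fun z => q.eval z - p.eval z * Complex.exp (-((1:ℝ) * h z))) < ε / 2 := by
    refine hpw.trans_lt (lt_of_le_of_lt ?_ hL)
    have h1 : Real.exp (-(Real.log (ω (N 0)) / 2)) ≤ Real.exp (-(L / 2)) := by
      apply Real.exp_le_exp.2; linarith
    have h2 := Real.exp_pos (-(Real.log (ω (N K)) / 2))
    gcongr
    linarith
  have hUd : DifferentiableOn ℂ (fun z => p.eval z * Complex.exp (-((1:ℝ) * h z))) 𝔻 :=
    (poly_diff p _).mul ((hh.const_mul _).neg.cexp)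
  -- flip signs
  have hflip : ∀ n, ‖taylorCoeff (fun z => p.eval z * Complex.exp (-((1:ℝ) * h z)) - q.eval z) n‖
      = ‖taylorCoeff (fun z => q.eval z - p.eval z * Complex.exp (-((1:ℝ) * h z))) n‖ := by
    intro n
    rw [tc_sub hUd (poly_diff q _), tc_sub (poly_diff q _) hUd, norm_sub_rev]
  have hpm' : MemA ω (fun z => p.eval z * Complex.exp (-((1:ℝ) * h z)) - q.eval z) := by
    refine ⟨(hUd.sub (poly_diff q _)).analyticOnNhd Metric.isOpen_ball, ?_⟩
    simp only [hflip]
    exact hpm.2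
  have hpw' : wN ω (fun z => p.eval z * Complex.exp (-((1:ℝ) * h z)) - q.eval z) < ε / 2 := by
    refine lt_of_eq_of_lt ?_ hpw2
    unfold wN wNormSq
    simp only [hflip]
  obtain ⟨t1, t2⟩ := wN_triangle hωpos hUd (poly_diff q _) hg.diff hpm' hqm
  have hlt := t2.trans_lt (add_lt_add hpw' hqw)
  rw [add_halves] at hlt
  have hCc : (C:ℂ) ≠ 0 := by exact_mod_cast hC.ne'
  have hcongr := tc_congr (F := fun z => (Polynomial.C (C:ℂ)⁻¹ * p).eval z * f z - g z)
    (G := fun z => p.eval z * Complex.exp (-((1:ℝ) * h z)) - g z) (by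
      intro z hz
      simp only [Polynomial.eval_mul, Polynomial.eval_C, hfh z hz, Complex.ofReal_one, one_mul]
      field_simp)
  refine ⟨Polynomial.C (C:ℂ)⁻¹ * p, ⟨?_, ?_⟩, ?_⟩
  · exact (((poly_diff _ _).mul hfd).sub hg.diff).analyticOnNhd Metric.isOpen_ball
  · simp only [hcongr]
    exact t1.2
  · rw [wN, Real.sqrt_lt' hε] at hlt
    refine lt_of_eq_of_lt ?_ hlt
    unfold wNormSq
    simp only [hcongr]
end

section
/- Let ω be a weight sequence. Then every bounded analytic function on the unit disk is a multiplier of A²_ω; more precisely, for every f in H^∞ and every φ in A²_ω, the product fφ belongs to A²_ω and ‖fφ‖_{ω,2} ≤ ‖f‖_∞ ‖φ‖_{ω,2}. -/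
open MeasureTheory Filter

/-- The `H^∞` norm: supremum of `|f|` over the unit disk. -/
noncomputable def hInfNorm (f : ℂ → ℂ) : ℝ :=
  ⨆ z : Metric.ball (0 : ℂ) 1, ‖f (z : ℂ)‖

/-- Parseval for absolutely convergent power series on the circle. -/
lemma aux_parseval (c : ℕ → ℂ) (hc : Summable fun n => ‖c n‖) :
    ∃ G : C(UnitAddCircle, ℂ),
      (∀ t, G t = ∑' n, c n * (fourier 1 t : ℂ) ^ n) ∧
      HasSum (fun n => ‖c n‖ ^ 2)
        (‖ContinuousMap.toLp (E := ℂ) 2 AddCircle.haarAddCircle ℂ G‖ ^ 2) := by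
  have hs : Summable fun n : ℕ => c n • (fourier (n : ℤ) : C(UnitAddCircle, ℂ)) := by
    apply Summable.of_norm
    simpa [norm_smul, fourier_norm] using hc
  have hpow : ∀ (n : ℕ) (t : UnitAddCircle),
      (fourier (n : ℤ) t : ℂ) = (fourier 1 t : ℂ) ^ n := by
    intro n t
    induction n with
    | zero => simp
    | succ k ih => rw [Nat.cast_succ, fourier_add, ih, pow_succ]
  refine ⟨∑' n : ℕ, c n • fourier (n : ℤ), ?_, ?_⟩
  · intro t
    have h := hs.hasSum.mapL (ContinuousMap.evalCLM ℂ t)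
    have h2 := h.tsum_eq
    simp only [ContinuousMap.evalCLM_apply, ContinuousMap.smul_apply, hpow, smul_eq_mul] at h2
    exact h2.symm
  · have h := hs.hasSum.mapL (ContinuousMap.toLp (E := ℂ) 2 (AddCircle.haarAddCircle (T := 1)) ℂ)
    have h2 := (h.norm.pow 2)
    refine h2.congr ?_
    intro s
    have ho : Orthonormal ℂ (fun n : ℕ => (fourierLp (T := 1) 2 (n : ℤ))) :=
      orthonormal_fourier.comp _ Nat.cast_injective
    have h3 := ho.inner_sum c c s
    rw [inner_self_eq_norm_sq_to_K] at h3
    simp only [map_smul]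
    have h4 : ∀ n, (starRingEnd ℂ) (c n) * c n = ((‖c n‖ ^ 2 : ℝ) : ℂ) := by
      intro n
      rw [mul_comm, Complex.mul_conj, Complex.normSq_eq_norm_sq]
    simp only [h4] at h3
    refine Complex.ofReal_injective ?_
    push_cast
    push_cast at h3
    exact h3

lemma aux_conv (α β : ℕ → ℂ) (hα : Summable fun n => ‖α n‖) (M : ℝ)
    (hM : ∀ z : ℂ, ‖z‖ = 1 → ‖∑' n, α n * z ^ n‖ ≤ M) (N : ℕ) :
    ∑ n ∈ Finset.range N, ‖∑ k ∈ Finset.range (n + 1), α k * β (n - k)‖ ^ 2 ≤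
      M ^ 2 * ∑ n ∈ Finset.range N, ‖β n‖ ^ 2 := by
  have hM0 : 0 ≤ M := (norm_nonneg _).trans (hM 1 (by simp))
  set b : ℕ → ℂ := fun n => if n < N then β n else 0 with hb
  have hb0 : ∀ n ∉ Finset.range N, b n = 0 := by
    intro n hn
    simp only [Finset.mem_range] at hn
    simp [hb, hn]
  have hbs : Summable fun n => ‖b n‖ :=
    summable_of_ne_finset_zero (s := Finset.range N) (fun n hn => by simp [hb0 n hn])
  set c : ℕ → ℂ := fun n => ∑ k ∈ Finset.range (n + 1), α k * b (n - k) with hc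
  have hcs : Summable fun n => ‖c n‖ := summable_norm_sum_mul_range_of_summable_norm hα hbs
  obtain ⟨B, hB, hB2⟩ := aux_parseval b hbs
  obtain ⟨C, hC, hC2⟩ := aux_parseval c hcs
  have hpt : ∀ t, ‖C t‖ ≤ M * ‖B t‖ := by
    intro t
    have hz : ‖(fourier 1 t : ℂ)‖ = 1 := by
      rw [fourier_apply]
      exact Circle.norm_coe _
    rw [hB, hC]
    generalize (fourier 1 t : ℂ) = z at hz
    have e1 : ∀ u : ℕ → ℂ, Summable (fun n => ‖u n‖) → Summable fun n => ‖u n * z ^ n‖ := by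
      intro u hu
      simpa [hz] using hu
    have h := tsum_mul_tsum_eq_tsum_sum_range_of_summable_norm (e1 α hα) (e1 b hbs)
    have h' : ∑' n, c n * z ^ n = (∑' n, α n * z ^ n) * ∑' n, b n * z ^ n := by
      rw [h]
      congr 1
      ext n
      rw [hc, Finset.sum_mul]
      refine Finset.sum_congr rfl fun k hk => ?_
      have hk' : k + (n - k) = n := by
        have := Finset.mem_range.1 hk
        omega
      calc α k * b (n - k) * z ^ n = α k * b (n - k) * z ^ (k + (n - k)) := by rw [hk']
        _ = _ := by rw [pow_add]; ring
    rw [h', norm_mul]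
    exact mul_le_mul_of_nonneg_right (hM z hz) (norm_nonneg _)
  have hL := Lp.norm_le_mul_norm_of_ae_le_mul (c := M)
    (f := ContinuousMap.toLp (E := ℂ) 2 (AddCircle.haarAddCircle (T := 1)) ℂ C)
    (g := ContinuousMap.toLp (E := ℂ) 2 (AddCircle.haarAddCircle (T := 1)) ℂ B) (by
      filter_upwards [ContinuousMap.coeFn_toLp (p := 2) (𝕜 := ℂ)
        (AddCircle.haarAddCircle (T := 1)) C,
        ContinuousMap.coeFn_toLp (p := 2) (𝕜 := ℂ) (AddCircle.haarAddCircle (T := 1)) B]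
        with t h1 h2
      rw [h1, h2]
      exact hpt t)
  have hBsum := hB2.unique (hasSum_sum_of_ne_finset_zero (s := Finset.range N)
    (fun n hn => by simp [hb0 n hn]))
  have hBe : ∑ n ∈ Finset.range N, ‖b n‖ ^ 2 = ∑ n ∈ Finset.range N, ‖β n‖ ^ 2 := by
    refine Finset.sum_congr rfl fun n hn => ?_
    simp [hb, Finset.mem_range.1 hn]
  have hCe : ∑ n ∈ Finset.range N, ‖∑ k ∈ Finset.range (n + 1), α k * β (n - k)‖ ^ 2
      = ∑ n ∈ Finset.range N, ‖c n‖ ^ 2 := by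
    refine Finset.sum_congr rfl fun n hn => ?_
    have : ∑ k ∈ Finset.range (n + 1), α k * β (n - k) = c n := by
      refine Finset.sum_congr rfl fun k hk => ?_
      have : n - k < N := by
        have := Finset.mem_range.1 hn
        omega
      simp [hb, this]
    rw [this]
  rw [hCe, ← hBe, ← hBsum, ← mul_pow]
  refine (sum_le_hasSum _ (fun n _ => by positivity) hC2).trans ?_
  gcongr

lemma aux_hasSum (f : ℂ → ℂ) (hf : AnalyticOnNhd ℂ f (Metric.ball (0 : ℂ) 1)) (z : ℂ)
    (hz : ‖z‖ < 1) : HasSum (fun n => taylorCoeff f n * z ^ n) (f z) := by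
  have h := Complex.hasSum_taylorSeries_on_ball (c := 0) (r := 1) (z := z)
    (f := f) (by simpa using hf.differentiableOn) (by simpa using hz)
  refine h.congr_fun ?_
  intro n
  simp only [taylorCoeff, smul_eq_mul, sub_zero]
  ring

lemma aux_mul (f g : ℂ → ℂ) (hf : AnalyticAt ℂ f 0) (hg : AnalyticAt ℂ g 0) (n : ℕ) :
    taylorCoeff (fun z => f z * g z) n =
      ∑ k ∈ Finset.range (n + 1), taylorCoeff f k * taylorCoeff g (n - k) := by
  unfold taylorCoeff
  rw [iteratedDeriv_fun_mul hf.contDiffAt hg.contDiffAt, Finset.sum_div]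
  refine Finset.sum_congr rfl fun i hi => ?_
  rw [Nat.cast_choose _ (by grind)]
  field_simp [Nat.factorial_ne_zero]

lemma aux_abel (w d : ℕ → ℝ) (hw : Antitone w)
    (hd : ∀ N, 0 ≤ ∑ n ∈ Finset.range N, d n) (N : ℕ) :
    w N * ∑ n ∈ Finset.range N, d n ≤ ∑ n ∈ Finset.range N, w n * d n := by
  induction N with
  | zero => simp
  | succ N ih =>
    have h1 := mul_le_mul_of_nonneg_right (hw (Nat.le_succ N)) (hd (N + 1))
    rw [Finset.sum_range_succ (fun n => w n * d n)]
    refine h1.trans ?_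
    rw [Finset.sum_range_succ, mul_add]
    linarith

lemma aux_main (f φ : ℂ → ℂ) (hf : AnalyticOnNhd ℂ f (Metric.ball (0 : ℂ) 1))
    (hφ : AnalyticOnNhd ℂ φ (Metric.ball (0 : ℂ) 1)) (M : ℝ)
    (hM : ∀ z : ℂ, ‖z‖ < 1 → ‖f z‖ ≤ M) (N : ℕ) :
    ∑ n ∈ Finset.range N, ‖taylorCoeff (fun z => f z * φ z) n‖ ^ 2 ≤
      M ^ 2 * ∑ n ∈ Finset.range N, ‖taylorCoeff φ n‖ ^ 2 := by
  have h0 : (0 : ℂ) ∈ Metric.ball (0 : ℂ) 1 := by simp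
  simp only [aux_mul f φ (hf 0 h0) (hφ 0 h0)]
  have key : ∀ r : ℝ, r ∈ Set.Ioo (0 : ℝ) 1 →
      ∑ n ∈ Finset.range N, ‖∑ k ∈ Finset.range (n + 1),
        (taylorCoeff f k * (r : ℂ) ^ k) * taylorCoeff φ (n - k)‖ ^ 2 ≤
      M ^ 2 * ∑ n ∈ Finset.range N, ‖taylorCoeff φ n‖ ^ 2 := by
    intro r hr
    have hr1 : ‖(r : ℂ)‖ < 1 := by
      rw [Complex.norm_real, Real.norm_eq_abs, abs_of_pos hr.1]
      exact hr.2
    refine aux_conv (fun k => taylorCoeff f k * (r : ℂ) ^ k) (taylorCoeff φ) ?_ M ?_ N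
    · exact (aux_hasSum f hf r hr1).summable.norm
    · intro z hz
      have hz1 : ‖(r : ℂ) * z‖ < 1 := by rw [norm_mul, hz, mul_one]; exact hr1
      have h := (aux_hasSum f hf _ hz1).tsum_eq
      simp only [mul_pow, ← mul_assoc] at h
      rw [h]
      exact hM _ hz1
  have hcont : Continuous fun r : ℝ => ∑ n ∈ Finset.range N, ‖∑ k ∈ Finset.range (n + 1),
        (taylorCoeff f k * (r : ℂ) ^ k) * taylorCoeff φ (n - k)‖ ^ 2 := by fun_prop
  have hsub : Set.Ioo (0 : ℝ) 1 ⊆ {r : ℝ | ∑ n ∈ Finset.range N, ‖∑ k ∈ Finset.range (n + 1),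
        (taylorCoeff f k * (r : ℂ) ^ k) * taylorCoeff φ (n - k)‖ ^ 2 ≤
      M ^ 2 * ∑ n ∈ Finset.range N, ‖taylorCoeff φ n‖ ^ 2} := key
  have hcl := closure_minimal hsub
    (isClosed_le hcont continuous_const)
  have h1 : (1 : ℝ) ∈ closure (Set.Ioo (0 : ℝ) 1) := by
    rw [closure_Ioo (by norm_num)]
    simp
  simpa using hcl h1

/-- Every `H^∞` function is a multiplier of `A²_ω`:
`fφ ∈ A²_ω` and `‖fφ‖_{ω,2} ≤ ‖f‖_∞ ‖φ‖_{ω,2}`. -/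
theorem hInf_multiplier
    (ω : ℕ → ℝ) (hωpos : ∀ n, 0 < ω n) (hωmono : Monotone ω)
    (hωtop : Tendsto ω atTop atTop)
    (hωo : (fun n : ℕ => Real.log (ω n)) =o[atTop] (fun n : ℕ => (n : ℝ)))
    (f : ℂ → ℂ) (hf : AnalyticOnNhd ℂ f (Metric.ball (0 : ℂ) 1))
    (hfb : ∃ C : ℝ, ∀ z ∈ Metric.ball (0 : ℂ) 1, ‖f z‖ ≤ C)
    (φ : ℂ → ℂ) (hφ : MemA ω φ) :
    MemA ω (fun z => f z * φ z) ∧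
      Real.sqrt (wNormSq ω (fun z => f z * φ z)) ≤
        hInfNorm f * Real.sqrt (wNormSq ω φ) := by
  obtain ⟨K, hK⟩ := hfb
  have hM : ∀ z : ℂ, ‖z‖ < 1 → ‖f z‖ ≤ hInfNorm f := by
    intro z hz
    refine le_ciSup (f := fun z : Metric.ball (0 : ℂ) 1 => ‖f (z : ℂ)‖) ?_ ⟨z, by simpa using hz⟩
    refine ⟨K, ?_⟩
    rintro _ ⟨y, rfl⟩
    exact hK y y.2
  have hM0 : 0 ≤ hInfNorm f := (norm_nonneg _).trans (hM 0 (by simp))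
  obtain ⟨hφa, hφs⟩ := hφ
  have hw : Antitone fun n => 1 / ω n ^ 2 := by
    intro m n hmn
    exact one_div_le_one_div_of_le (pow_pos (hωpos m) 2)
      (pow_le_pow_left₀ (hωpos m).le (hωmono hmn) 2)
  have hpart : ∀ N, ∑ n ∈ Finset.range N, ‖taylorCoeff (fun z => f z * φ z) n‖ ^ 2 / ω n ^ 2 ≤
      hInfNorm f ^ 2 * wNormSq ω φ := by
    intro N
    have hd : ∀ N, 0 ≤ ∑ n ∈ Finset.range N, (hInfNorm f ^ 2 * ‖taylorCoeff φ n‖ ^ 2 -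
        ‖taylorCoeff (fun z => f z * φ z) n‖ ^ 2) := by
      intro N
      rw [Finset.sum_sub_distrib, ← Finset.mul_sum, sub_nonneg]
      exact aux_main f φ hf hφa _ hM N
    have h := aux_abel _ _ hw hd N
    have h2 := (mul_nonneg (one_div_nonneg.2 (pow_pos (hωpos N) 2).le) (hd N)).trans h
    have h3 : ∑ n ∈ Finset.range N, 1 / ω n ^ 2 * (hInfNorm f ^ 2 * ‖taylorCoeff φ n‖ ^ 2 -
        ‖taylorCoeff (fun z => f z * φ z) n‖ ^ 2) =
        hInfNorm f ^ 2 * ∑ n ∈ Finset.range N, ‖taylorCoeff φ n‖ ^ 2 / ω n ^ 2 -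
        ∑ n ∈ Finset.range N, ‖taylorCoeff (fun z => f z * φ z) n‖ ^ 2 / ω n ^ 2 := by
      rw [Finset.mul_sum, ← Finset.sum_sub_distrib]
      refine Finset.sum_congr rfl fun n _ => ?_
      ring
    rw [h3, sub_nonneg] at h2
    refine h2.trans (mul_le_mul_of_nonneg_left ?_ (sq_nonneg _))
    exact hφs.sum_le_tsum _ (fun n _ => by positivity)
  have hsum : Summable fun n => ‖taylorCoeff (fun z => f z * φ z) n‖ ^ 2 / ω n ^ 2 :=
    summable_of_sum_range_le (fun n => by positivity) hpart
  refine ⟨⟨hf.mul hφa, hsum⟩, ?_⟩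
  have hle : wNormSq ω (fun z => f z * φ z) ≤ hInfNorm f ^ 2 * wNormSq ω φ :=
    hsum.tsum_le_of_sum_range_le hpart
  calc Real.sqrt (wNormSq ω (fun z => f z * φ z))
      ≤ Real.sqrt (hInfNorm f ^ 2 * wNormSq ω φ) := Real.sqrt_le_sqrt hle
    _ = _ := by rw [Real.sqrt_mul (sq_nonneg _), Real.sqrt_sq hM0]
end

section
/- Let ω be any sequence of positive real numbers with ω(2n) = 1 for every n ≥ 0, and let A²_ω be the space of analytic functions f(z) = ∑_{n≥0} a_n zⁿ on the unit disk with ∑_{n≥0} |a_n|²/ω(n)² < ∞. Let ν be a nonzero finite positive Borel measure on the unit circle T singular with respect to Lebesgue measure and let U be the singular inner function associated with ν. Then the function z ↦ U(z²) belongs to A²_ω and is not cyclic in A²_ω. -/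
open MeasureTheory

/-- The singular inner function associated with a (finite positive) measure
`ν` on the unit circle, parametrized by the angle `t ∈ [0, 2π)`. -/
noncomputable def singInner (ν : Measure ℝ) (z : ℂ) : ℂ :=
  Complex.exp
    (-∫ t : ℝ, (Complex.exp (t * Complex.I) + z) / (Complex.exp (t * Complex.I) - z) ∂ν)

open Filter Topology

lemma parseval_aux {F : ℂ → ℂ} (hF : DifferentiableOn ℂ F (Metric.ball 0 1)) {r : ℝ}
    (hr0 : 0 ≤ r) (hr1 : r < 1) :
    HasSum (fun n => ‖taylorCoeff F n‖ ^ 2 * r ^ (2 * n))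
      ((2 * Real.pi)⁻¹ * ∫ θ in (0:ℝ)..2 * Real.pi, ‖F (circleMap 0 r θ)‖ ^ 2) := by
  have hmem : ∀ θ, circleMap 0 r θ ∈ Metric.ball (0:ℂ) 1 := by
    intro θ; simp [abs_of_nonneg hr0, hr1]
  have hs : ∀ θ, HasSum (fun n => taylorCoeff F n * (circleMap 0 r θ) ^ n) (F (circleMap 0 r θ)) := by
    intro θ
    have := Complex.hasSum_taylorSeries_on_ball hF (hmem θ)
    have e : (fun n => taylorCoeff F n * (circleMap 0 r θ) ^ n) =
        fun n : ℕ => ((n.factorial : ℂ))⁻¹ • (circleMap 0 r θ - 0) ^ n • iteratedDeriv n F 0 := by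
      funext n
      rw [taylorCoeff, sub_zero, smul_eq_mul, smul_eq_mul]; ring
    rw [e]; exact this
  have hsum : Summable (fun n => ‖taylorCoeff F n‖ * r ^ n) := by
    have := (hs 0).summable.norm
    simpa [abs_of_nonneg hr0] using this
  set S := ∑' n, ‖taylorCoeff F n‖ * r ^ n
  let P : ℕ → Polynomial ℂ := fun N =>
    ∑ n ∈ Finset.range N, Polynomial.monomial n (taylorCoeff F n * (r:ℂ) ^ n)
  have hcoef : ∀ N n, (P N).coeff n = if n < N then taylorCoeff F n * (r:ℂ) ^ n else 0 := by
    intro N n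
    simp [P, Polynomial.coeff_monomial]
  have hev : ∀ N θ, (P N).eval (circleMap 0 1 θ) =
      ∑ n ∈ Finset.range N, taylorCoeff F n * (circleMap 0 r θ) ^ n := by
    intro N θ
    simp [P, Polynomial.eval_finsetSum, circleMap, mul_pow, mul_assoc]
  rw [hasSum_iff_tendsto_nat_of_nonneg (fun n => by positivity)]
  have hpar : ∀ N, ∑ n ∈ Finset.range N, ‖taylorCoeff F n‖ ^ 2 * r ^ (2 * n) =
      (2 * Real.pi)⁻¹ * ∫ θ in (0:ℝ)..2 * Real.pi, ‖(P N).eval (circleMap 0 1 θ)‖ ^ 2 := by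
    intro N
    have h := Polynomial.sum_sq_norm_coeff_eq_circleAverage (P N)
    rw [Real.circleAverage_def, smul_eq_mul] at h
    rw [← h]
    symm
    apply Finset.sum_subset_zero_on_sdiff (f := fun n => ‖(P N).coeff n‖ ^ 2)
    · intro n hn
      rw [Polynomial.mem_support_iff, hcoef] at hn
      simp at hn ⊢
      exact hn.1
    · intro n hn
      simp only [Finset.mem_sdiff, Finset.mem_range, Polynomial.mem_support_iff, not_not] at hn
      have h2 := hn.2
      rw [hcoef, if_pos hn.1] at h2
      have h3 := congrArg (fun z => ‖z‖ ^ 2) h2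
      simp only [norm_mul, norm_pow, mul_pow, Complex.norm_real, Real.norm_eq_abs, abs_of_nonneg hr0] at h3
      rw [pow_mul', h3]; simp
    · intro n hn
      have hc : n < N := by
        rw [Polynomial.mem_support_iff, hcoef] at hn
        simp at hn; exact hn.1
      simp only [hcoef, if_pos hc]
      rw [norm_mul, mul_pow, norm_pow, Complex.norm_real, Real.norm_eq_abs, abs_of_nonneg hr0,
        pow_mul']
  simp_rw [hpar]
  apply Tendsto.const_mul
  apply intervalIntegral.tendsto_integral_filter_of_dominated_convergence (fun _ => S ^ 2)
  · refine Eventually.of_forall fun N => Continuous.aestronglyMeasurable ?_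
    have := continuous_circleMap (0:ℂ) 1
    fun_prop
  · refine Eventually.of_forall fun N => Eventually.of_forall fun θ _ => ?_
    rw [hev, norm_pow, norm_norm]
    gcongr
    refine (norm_sum_le _ _).trans ?_
    refine le_trans (le_of_eq ?_) (hsum.sum_le_tsum (Finset.range N) (fun n _ => by positivity))
    simp [abs_of_nonneg hr0]
  · simp
  · refine Eventually.of_forall fun θ _ => ?_
    simp_rw [hev]
    exact ((hs θ).tendsto_sum_nat.norm.pow 2)

lemma circle_cont {F : ℂ → ℂ} (hF : DifferentiableOn ℂ F (Metric.ball 0 1)) {r : ℝ}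
    (hr0 : 0 ≤ r) (hr1 : r < 1) : Continuous (fun θ => F (circleMap 0 r θ)) := by
  refine hF.continuousOn.comp_continuous (continuous_circleMap 0 r) ?_
  intro θ; simp [abs_of_nonneg hr0, hr1]

lemma mean_value {F : ℂ → ℂ} (hF : DifferentiableOn ℂ F (Metric.ball 0 1)) {r : ℝ}
    (hr0 : 0 ≤ r) (hr1 : r < 1) :
    ∫ θ in (0:ℝ)..2 * Real.pi, F (circleMap 0 r θ) = 2 * Real.pi * F 0 := by
  have h : DiffContOnCl ℂ F (Metric.ball 0 |r|) := by
    apply DifferentiableOn.diffContOnCl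
    refine hF.mono ?_
    refine Metric.closure_ball_subset_closedBall.trans ?_
    rw [abs_of_nonneg hr0]
    exact Metric.closedBall_subset_ball hr1
  have h2 := h.circleAverage
  rw [Real.circleAverage_def] at h2
  rw [← h2, Complex.real_smul]
  have : (Real.pi : ℂ) ≠ 0 := by exact_mod_cast Real.pi_ne_zero
  push_cast
  field_simp

lemma summable_of_bounded {F : ℂ → ℂ} (hF : DifferentiableOn ℂ F (Metric.ball 0 1))
    (hb : ∀ z ∈ Metric.ball (0:ℂ) 1, ‖F z‖ ≤ 1) :
    Summable (fun n => ‖taylorCoeff F n‖ ^ 2) := by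
  apply summable_of_sum_range_le (c := 1) (fun n => by positivity)
  intro N
  have hlim : Tendsto (fun r : ℝ => ∑ n ∈ Finset.range N, ‖taylorCoeff F n‖ ^ 2 * r ^ (2 * n))
      (𝓝[<] 1) (𝓝 (∑ n ∈ Finset.range N, ‖taylorCoeff F n‖ ^ 2)) := by
    have : Continuous (fun r : ℝ => ∑ n ∈ Finset.range N, ‖taylorCoeff F n‖ ^ 2 * r ^ (2 * n)) := by
      fun_prop
    have h := (this.tendsto 1).mono_left (nhdsWithin_le_nhds (s := Set.Iio 1))
    simpa using h
  refine le_of_tendsto hlim ?_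
  filter_upwards [Ioo_mem_nhdsLT (show (0:ℝ) < 1 by norm_num)] with r hr
  have hp := parseval_aux hF hr.1.le hr.2
  refine (hp.summable.sum_le_tsum _ (fun n _ => by have := hr.1; positivity)).trans ?_
  rw [hp.tsum_eq]
  have h1 : ∫ θ in (0:ℝ)..2 * Real.pi, ‖F (circleMap 0 r θ)‖ ^ 2 ≤
      ∫ θ in (0:ℝ)..2 * Real.pi, (1:ℝ) := by
    apply intervalIntegral.integral_mono_on (by positivity)
    · exact ((circle_cont hF hr.1.le hr.2).norm.pow 2).intervalIntegrable _ _
    · simp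
    · intro θ _
      apply pow_le_one₀ (norm_nonneg _)
      apply hb
      simp [abs_of_nonneg hr.1.le, hr.2]
  have hpi := Real.pi_pos
  calc _ ≤ (2 * Real.pi)⁻¹ * ∫ θ in (0:ℝ)..2 * Real.pi, (1:ℝ) := by gcongr
    _ = 1 := by simp; field_simp

/-- Herglotz transform. -/
noncomputable def herg (μ : Measure ℝ) (z : ℂ) : ℂ :=
  ∫ t : ℝ, (Complex.exp (t * Complex.I) + z) / (Complex.exp (t * Complex.I) - z) ∂μ

lemma den_lb (t : ℝ) (z : ℂ) : 1 - ‖z‖ ≤ ‖Complex.exp (t * Complex.I) - z‖ := by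
  have := norm_sub_norm_le (Complex.exp (t * Complex.I)) z
  rwa [Complex.norm_exp_ofReal_mul_I] at this

lemma den_ne (t : ℝ) {z : ℂ} (hz : ‖z‖ < 1) : Complex.exp (t * Complex.I) - z ≠ 0 := by
  have := den_lb t z
  rw [← norm_pos_iff]; linarith

lemma ker_cont {z : ℂ} (hz : ‖z‖ < 1) : Continuous (fun t : ℝ =>
    (Complex.exp (t * Complex.I) + z) / (Complex.exp (t * Complex.I) - z)) :=
  Continuous.div (by fun_prop) (by fun_prop) (fun t => den_ne t hz)

lemma ker_int (μ : Measure ℝ) [IsFiniteMeasure μ] {z : ℂ} (hz : ‖z‖ < 1) :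
    Integrable (fun t : ℝ =>
      (Complex.exp (t * Complex.I) + z) / (Complex.exp (t * Complex.I) - z)) μ := by
  refine Integrable.of_bound (ker_cont hz).aestronglyMeasurable (2 / (1 - ‖z‖))
    (Eventually.of_forall fun t => ?_)
  rw [norm_div]
  have h1 := den_lb t z
  have h2 := norm_add_le (Complex.exp (t * Complex.I)) z
  rw [Complex.norm_exp_ofReal_mul_I] at h2
  have h3 : 0 < 1 - ‖z‖ := by linarith
  gcongr
  linarith

lemma ker_re (t : ℝ) {z : ℂ} (hz : ‖z‖ < 1) :
    ((Complex.exp (t * Complex.I) + z) / (Complex.exp (t * Complex.I) - z)).re =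
      (1 - ‖z‖ ^ 2) / ‖Complex.exp (t * Complex.I) - z‖ ^ 2 := by
  have h1 : ‖Complex.exp (t * Complex.I)‖ ^ 2 = 1 := by simp [Complex.norm_exp_ofReal_mul_I]
  have h0 := den_ne t hz
  generalize Complex.exp (t * Complex.I) = w at *
  rw [Complex.div_re, Complex.normSq_eq_norm_sq, ← add_div]
  congr 1
  rw [← h1, ← Complex.normSq_eq_norm_sq, ← Complex.normSq_eq_norm_sq]
  simp [Complex.normSq_apply]; ring

lemma herg_re (μ : Measure ℝ) [IsFiniteMeasure μ] {z : ℂ} (hz : ‖z‖ < 1) :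
    (herg μ z).re = ∫ t : ℝ, (1 - ‖z‖ ^ 2) / ‖Complex.exp (t * Complex.I) - z‖ ^ 2 ∂μ := by
  unfold herg
  have := integral_re (ker_int μ hz)
  simp only [RCLike.re_eq_complex_re] at this
  rw [← this]
  simp_rw [ker_re _ hz]

lemma herg_re_nonneg (μ : Measure ℝ) [IsFiniteMeasure μ] {z : ℂ} (hz : ‖z‖ < 1) :
    0 ≤ (herg μ z).re := by
  rw [herg_re μ hz]
  apply integral_nonneg
  intro t
  have : ‖z‖ ^ 2 ≤ 1 := pow_le_one₀ (norm_nonneg _) hz.le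
  have : 0 ≤ 1 - ‖z‖ ^ 2 := by linarith
  dsimp
  positivity

lemma herg_zero (μ : Measure ℝ) [IsFiniteMeasure μ] : herg μ 0 = (μ.real Set.univ : ℂ) := by
  simp [herg, Complex.exp_ne_zero]

lemma herg_diff (μ : Measure ℝ) [IsFiniteMeasure μ] :
    DifferentiableOn ℂ (herg μ) (Metric.ball 0 1) := by
  intro z hz
  rw [mem_ball_zero_iff] at hz
  apply DifferentiableAt.differentiableWithinAt
  obtain ⟨ρ, hρ1, hρ2⟩ := exists_between hz
  have hs : Metric.ball (0:ℂ) ρ ∈ 𝓝 z := Metric.isOpen_ball.mem_nhds (by simpa using hρ1)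
  have := hasDerivAt_integral_of_dominated_loc_of_deriv_le (μ := μ) (𝕜 := ℂ)
    (F := fun z t => (Complex.exp (t * Complex.I) + z) / (Complex.exp (t * Complex.I) - z))
    (F' := fun z t => 2 * Complex.exp (t * Complex.I) / (Complex.exp (t * Complex.I) - z) ^ 2)
    (bound := fun _ => 2 / (1 - ρ) ^ 2) hs ?_ (ker_int μ hz) ?_ ?_ (integrable_const _) ?_
  · exact this.2.differentiableAt
  · filter_upwards [hs] with x hx
    rw [mem_ball_zero_iff] at hx
    exact (ker_cont (hx.trans hρ2)).aestronglyMeasurable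
  · apply Continuous.aestronglyMeasurable
    exact Continuous.div (by fun_prop) (by fun_prop) (fun t => pow_ne_zero _ (den_ne t hz))
  · refine Eventually.of_forall fun t x hx => ?_
    rw [mem_ball_zero_iff] at hx
    have h1 := den_lb t x
    rw [norm_div, norm_mul, norm_pow, Complex.norm_exp_ofReal_mul_I]
    have h3 : 0 < 1 - ρ := by linarith
    simp only [Complex.norm_ofNat, mul_one]
    gcongr
    linarith
  · refine Eventually.of_forall fun t x hx => ?_
    rw [mem_ball_zero_iff] at hx
    have h0 := den_ne t (hx.trans hρ2)
    have := ((hasDerivAt_id x).const_add (Complex.exp (t * Complex.I))).div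
      ((hasDerivAt_id x).const_sub (Complex.exp (t * Complex.I))) h0
    refine this.congr_deriv ?_
    simp only [id]
    congr 1
    ring

lemma singInner_norm (ν : Measure ℝ) (z : ℂ) :
    ‖singInner ν z‖ = Real.exp (-(herg ν z).re) := by
  rw [singInner, Complex.norm_exp, Complex.neg_re]; rfl

lemma sq_mem {z : ℂ} (hz : z ∈ Metric.ball (0:ℂ) 1) : z ^ 2 ∈ Metric.ball (0:ℂ) 1 := by
  rw [mem_ball_zero_iff] at *
  rw [norm_pow]
  exact pow_lt_one₀ (norm_nonneg _) hz (by norm_num)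

lemma herg_sq_diff (μ : Measure ℝ) [IsFiniteMeasure μ] :
    DifferentiableOn ℂ (fun z => herg μ (z ^ 2)) (Metric.ball 0 1) :=
  (herg_diff μ).comp (by fun_prop) (fun _ hz => sq_mem hz)

lemma f_diff (μ : Measure ℝ) [IsFiniteMeasure μ] :
    DifferentiableOn ℂ (fun z => singInner μ (z ^ 2)) (Metric.ball 0 1) :=
  (herg_sq_diff μ).neg.cexp

lemma f_le_one (μ : Measure ℝ) [IsFiniteMeasure μ] {z : ℂ} (hz : z ∈ Metric.ball (0:ℂ) 1) :
    ‖singInner μ (z ^ 2)‖ ≤ 1 := by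
  rw [singInner_norm, Real.exp_le_one_iff]
  have := herg_re_nonneg μ (mem_ball_zero_iff.1 (sq_mem hz))
  linarith

lemma null_angles {K : Set ℝ} (hK0 : volume K = 0) :
    ∀ᵐ θ : ℝ, (circleMap 0 1 θ) ^ 2 ∉ (fun t : ℝ => Complex.exp (t * Complex.I)) '' K := by
  have hn : volume (⋃ k : ℤ, (fun θ : ℝ => 2 * θ) ⁻¹' ((fun x : ℝ => x + k * (2 * Real.pi)) ⁻¹' K)) = 0 := by
    rw [measure_iUnion_null_iff]
    intro k
    rw [Real.volume_preimage_mul_left (by norm_num), measure_preimage_add_right, hK0, mul_zero]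
  rw [ae_iff]
  refine measure_mono_null ?_ hn
  intro θ hθ
  simp only [not_not, Set.mem_ofPred_eq] at hθ
  obtain ⟨t, ht, he⟩ := hθ
  simp only [circleMap_zero, Complex.ofReal_one, one_mul] at he
  rw [← Complex.exp_nat_mul, Complex.exp_eq_exp_iff_exists_int] at he
  obtain ⟨k, hk⟩ := he
  have hk2 := congrArg Complex.im hk
  simp at hk2
  rw [Set.mem_iUnion]
  refine ⟨k, ?_⟩
  simp only [Set.mem_preimage]
  rwa [← hk2]

lemma herg_radial {μ : Measure ℝ} [IsFiniteMeasure μ] {K : Set ℝ} (hK : IsCompact K)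
    (hμ : ∀ᵐ t ∂μ, t ∈ K) {w : ℂ} (hw1 : ‖w‖ = 1)
    (hw : w ∉ (fun t : ℝ => Complex.exp (t * Complex.I)) '' K) :
    Tendsto (fun s : ℝ => (herg μ (s * w)).re) (𝓝[<] 1) (𝓝 0) := by
  have hcomp : IsCompact ((fun t : ℝ => Complex.exp (t * Complex.I)) '' K) :=
    hK.image (by fun_prop)
  obtain ⟨d, hd, hdb⟩ : ∃ d > 0, ∀ t ∈ K, d ≤ ‖Complex.exp (t * Complex.I) - w‖ := by
    obtain ⟨d, hd, hb⟩ := Metric.isOpen_iff.1 hcomp.isClosed.isOpen_compl w hw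
    refine ⟨d, hd, fun t ht => ?_⟩
    by_contra hlt
    push Not at hlt
    exact hb (by rwa [Metric.mem_ball, dist_eq_norm]) ⟨t, ht, rfl⟩
  have hup : Tendsto (fun s : ℝ => (1 - s ^ 2) / (d / 2) ^ 2 * μ.real Set.univ) (𝓝[<] 1) (𝓝 0) := by
    have hc : Continuous (fun s : ℝ => (1 - s ^ 2) / (d / 2) ^ 2 * μ.real Set.univ) := by fun_prop
    have h := (hc.tendsto 1).mono_left (nhdsWithin_le_nhds (s := Set.Iio 1))
    simpa using h
  have hev : ∀ᶠ s : ℝ in 𝓝[<] 1, s ∈ Set.Ioo (0:ℝ) 1 :=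
    Ioo_mem_nhdsLT (show (0:ℝ) < 1 by norm_num)
  refine tendsto_of_tendsto_of_tendsto_of_le_of_le' tendsto_const_nhds hup ?_ ?_
  · filter_upwards [hev] with s hs
    apply herg_re_nonneg
    rw [norm_mul, hw1, Complex.norm_real, Real.norm_of_nonneg hs.1.le, mul_one]; exact hs.2
  · filter_upwards [hev] with s hs
    have hn : ‖(s:ℂ) * w‖ = s := by
      rw [norm_mul, hw1, Complex.norm_real, Real.norm_of_nonneg hs.1.le, mul_one]
    rw [herg_re μ (by rw [hn]; exact hs.2), hn]
    have hle : ∀ᵐ t : ℝ ∂μ, ‖(1 - s ^ 2) / ‖Complex.exp ((t:ℝ) * Complex.I) - s * w‖ ^ 2‖ ≤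
        (1 - s ^ 2) / (d / 2) ^ 2 := by
      filter_upwards [hμ] with t ht
      have h1 := den_lb t (s * w)
      rw [hn] at h1
      have h2 := hdb t ht
      have h3 : ‖Complex.exp (t * Complex.I) - w‖ ≤
          ‖Complex.exp (t * Complex.I) - s * w‖ + ‖(s:ℂ) * w - w‖ := norm_sub_le_norm_sub_add_norm_sub _ _ _
      have h4 : ‖(s:ℂ) * w - w‖ = 1 - s := by
        rw [show (s:ℂ) * w - w = ((s - 1 : ℝ) : ℂ) * w by push_cast; ring, norm_mul, hw1,
          Complex.norm_real, Real.norm_eq_abs, abs_of_nonpos (by linarith [hs.2])]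
        ring
      have h5 : 0 ≤ 1 - s ^ 2 := by nlinarith [hs.1, hs.2]
      rw [Real.norm_of_nonneg (by positivity)]
      gcongr
      linarith
    have := norm_integral_le_of_norm_le_const hle
    exact (le_abs_self _).trans this

lemma inner_lb (ν : Measure ℝ) [IsFiniteMeasure ν] (hνsing : ν.MutuallySingular volume)
    {P : ℂ → ℂ} (hP : Differentiable ℂ P) {δ : ℝ} (hδ : 0 < δ) :
    ∃ r : ℝ, 0 < r ∧ r < 1 ∧ 2 * Real.pi * (‖P 0‖ ^ 2 - δ) ≤
      ∫ θ in (0:ℝ)..2 * Real.pi,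
        ‖P (circleMap 0 r θ) * singInner ν ((circleMap 0 r θ) ^ 2)‖ ^ 2 := by
  have hpi := Real.pi_pos
  obtain ⟨C, hC⟩ := (isCompact_closedBall (0:ℂ) 1).exists_bound_of_continuousOn
    hP.continuous.continuousOn
  have hC0 : 0 ≤ C := (norm_nonneg _).trans (hC 0 (by simp))
  -- the compact set
  obtain ⟨S, hSm, hS1, hS2⟩ := hνsing
  set ε : ℝ := δ / (4 * (C ^ 2 + 1)) with hε
  have hεpos : 0 < ε := by positivity
  obtain ⟨K, hKS, hK, hKε⟩ := hSm.compl.exists_isCompact_sdiff_lt (μ := ν)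
    (measure_ne_top _ _) (ε := ENNReal.ofReal ε) (by simpa using hεpos)
  have hK0 : volume K = 0 := measure_mono_null hKS hS2
  have hKc : ν.real Kᶜ ≤ ε := by
    have : ν Kᶜ ≤ ENNReal.ofReal ε := by
      have h1 : Kᶜ ⊆ S ∪ (Sᶜ \ K) := by
        intro x hx
        by_cases hxS : x ∈ S
        · exact Or.inl hxS
        · exact Or.inr ⟨hxS, hx⟩
      calc ν Kᶜ ≤ ν (S ∪ (Sᶜ \ K)) := measure_mono h1
        _ ≤ ν S + ν (Sᶜ \ K) := measure_union_le _ _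
        _ ≤ ENNReal.ofReal ε := by rw [hS1, zero_add]; exact hKε.le
    exact ENNReal.toReal_le_of_le_ofReal hεpos.le this
  set μ1 := ν.restrict K
  set μ2 := ν.restrict Kᶜ
  have hsplit : ∀ z : ℂ, ‖z‖ < 1 → herg ν z = herg μ1 z + herg μ2 z := fun z hz =>
    (integral_add_compl hK.measurableSet (ker_int ν hz)).symm
  have hmem : ∀ {r : ℝ}, 0 < r → r < 1 → ∀ θ, circleMap 0 r θ ∈ Metric.ball (0:ℂ) 1 := by
    intro r h0 h1 θ; simp [abs_of_pos h0, h1]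
  -- limit
  have hev : ∀ᶠ s : ℝ in 𝓝[<] 1, s ∈ Set.Ioo (0:ℝ) 1 :=
    Ioo_mem_nhdsLT (show (0:ℝ) < 1 by norm_num)
  let A : ℝ → ℝ → ℝ := fun r θ => ‖P (circleMap 0 r θ)‖ ^ 2 *
    Real.exp (-(2 * (herg μ1 ((circleMap 0 r θ) ^ 2)).re))
  have hAcont : ∀ r ∈ Set.Ioo (0:ℝ) 1, Continuous (A r) := by
    intro r hr
    have h1 := circle_cont (herg_sq_diff μ1) hr.1.le hr.2
    have h2 := circle_cont (hP.differentiableOn (s := Metric.ball 0 1)) hr.1.le hr.2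
    have h3 := Complex.continuous_re.comp h1
    exact (h2.norm.pow 2).mul (Real.continuous_exp.comp ((continuous_const.mul h3).neg))
  have hAbd : ∀ r ∈ Set.Ioo (0:ℝ) 1, ∀ θ, 0 ≤ A r θ ∧ A r θ ≤ C ^ 2 := by
    intro r hr θ
    refine ⟨by positivity, ?_⟩
    have h1 := herg_re_nonneg μ1 (mem_ball_zero_iff.1 (sq_mem (hmem hr.1 hr.2 θ)))
    have h2 : Real.exp (-(2 * (herg μ1 ((circleMap 0 r θ) ^ 2)).re)) ≤ 1 := by
      rw [Real.exp_le_one_iff]; linarith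
    have h3 := hC _ (Metric.ball_subset_closedBall (hmem hr.1 hr.2 θ))
    calc A r θ ≤ C ^ 2 * 1 := by
          apply mul_le_mul _ h2 (Real.exp_pos _).le (by positivity)
          gcongr
      _ = C ^ 2 := mul_one _
  have hlim : Tendsto (fun r => ∫ θ in (0:ℝ)..2 * Real.pi, A r θ) (𝓝[<] 1)
      (𝓝 (∫ θ in (0:ℝ)..2 * Real.pi, ‖P (circleMap 0 1 θ)‖ ^ 2)) := by
    apply intervalIntegral.tendsto_integral_filter_of_dominated_convergence (fun _ => C ^ 2)
    · filter_upwards [hev] with r hr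
      exact (hAcont r hr).aestronglyMeasurable
    · filter_upwards [hev] with r hr
      refine Eventually.of_forall fun θ _ => ?_
      rw [Real.norm_of_nonneg (hAbd r hr θ).1]
      exact (hAbd r hr θ).2
    · simp
    · filter_upwards [null_angles hK0] with θ hθ _
      have h1 := herg_radial (μ := μ1) hK (ae_restrict_mem hK.measurableSet)
        (w := (circleMap 0 1 θ) ^ 2) (by simp) hθ
      have hsq : Tendsto (fun r : ℝ => r ^ 2) (𝓝[<] 1) (𝓝[<] 1) := by
        apply tendsto_nhdsWithin_of_tendsto_nhds_of_eventually_within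
        · have hc : Continuous (fun r : ℝ => r ^ 2) := by fun_prop
          have h := (hc.tendsto 1).mono_left (nhdsWithin_le_nhds (s := Set.Iio 1))
          simpa using h
        · filter_upwards [hev] with r hr
          exact pow_lt_one₀ hr.1.le hr.2 (by norm_num)
      have h2 := h1.comp hsq
      have h3 : ∀ r : ℝ, ((r ^ 2 : ℝ) : ℂ) * (circleMap 0 1 θ) ^ 2 = (circleMap 0 r θ) ^ 2 := by
        intro r
        simp [circleMap, mul_pow]
      simp only [Function.comp_def, h3] at h2
      have h4 : Tendsto (fun r : ℝ => ‖P (circleMap 0 r θ)‖ ^ 2) (𝓝[<] 1)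
          (𝓝 (‖P (circleMap 0 1 θ)‖ ^ 2)) := by
        have hc : Continuous (fun r : ℝ => ‖P (circleMap 0 r θ)‖ ^ 2) := by
          have := hP.continuous
          unfold circleMap
          fun_prop
        exact (hc.tendsto 1).mono_left nhdsWithin_le_nhds
      have h5 := h4.mul ((Real.continuous_exp.tendsto _).comp ((h2.const_mul 2).neg))
      simpa using h5
  have hP1 : 2 * Real.pi * ‖P 0‖ ^ 2 ≤ ∫ θ in (0:ℝ)..2 * Real.pi, ‖P (circleMap 0 1 θ)‖ ^ 2 := by
    have h : DiffContOnCl ℂ (fun z => P z ^ 2) (Metric.ball 0 |(1:ℝ)|) :=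
      (hP.pow 2).diffContOnCl
    have h2 := h.circleAverage
    rw [Real.circleAverage_def] at h2
    have h3 := intervalIntegral.norm_integral_le_integral_norm
      (f := fun θ => P (circleMap 0 1 θ) ^ 2) (μ := volume) (show (0:ℝ) ≤ 2 * Real.pi by positivity)
    simp only [norm_pow] at h3
    rw [← norm_pow, ← h2, norm_smul, Real.norm_of_nonneg (by positivity), ← mul_assoc,
      mul_inv_cancel₀ (by positivity), one_mul]
    exact h3
  have hev2 : ∀ᶠ r in 𝓝[<] (1:ℝ), 2 * Real.pi * (‖P 0‖ ^ 2 - δ / 2) <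
      ∫ θ in (0:ℝ)..2 * Real.pi, A r θ := by
    apply hlim.eventually_const_lt
    nlinarith
  obtain ⟨r, hr, hr2⟩ := (hev.and hev2).exists
  refine ⟨r, hr.1, hr.2, ?_⟩
  have hB : ∫ θ in (0:ℝ)..2 * Real.pi, (herg μ2 ((circleMap 0 r θ) ^ 2)).re =
      2 * Real.pi * ν.real Kᶜ := by
    have h1 := mean_value (herg_sq_diff μ2) hr.1.le hr.2
    have h2 := Complex.reCLM.intervalIntegral_comp_comm
      ((circle_cont (herg_sq_diff μ2) hr.1.le hr.2).intervalIntegrable (μ := volume) 0 (2 * Real.pi))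
    simp only [Complex.reCLM_apply] at h2
    rw [h2, h1]
    simp [herg_zero, μ2]
  have hBc : Continuous (fun θ => (herg μ2 ((circleMap 0 r θ) ^ 2)).re) :=
    Complex.continuous_re.comp (circle_cont (herg_sq_diff μ2) hr.1.le hr.2)
  have hfc := circle_cont (f_diff ν) hr.1.le hr.2
  have hPc := circle_cont (hP.differentiableOn (s := Metric.ball 0 1)) hr.1.le hr.2
  have hmono : ∫ θ in (0:ℝ)..2 * Real.pi,
      (A r θ - 2 * C ^ 2 * (herg μ2 ((circleMap 0 r θ) ^ 2)).re) ≤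
      ∫ θ in (0:ℝ)..2 * Real.pi,
        ‖P (circleMap 0 r θ) * singInner ν ((circleMap 0 r θ) ^ 2)‖ ^ 2 := by
    apply intervalIntegral.integral_mono_on (by positivity)
    · exact ((hAcont r hr).sub (continuous_const.mul hBc)).intervalIntegrable _ _
    · exact ((hPc.mul hfc).norm.pow 2).intervalIntegrable _ _
    · intro θ _
      have hz := mem_ball_zero_iff.1 (sq_mem (hmem hr.1 hr.2 θ))
      have hA := hAbd r hr θ
      have hb := herg_re_nonneg μ2 hz
      have e1 : ‖P (circleMap 0 r θ) * singInner ν ((circleMap 0 r θ) ^ 2)‖ ^ 2 =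
          A r θ * Real.exp (-(2 * (herg μ2 ((circleMap 0 r θ) ^ 2)).re)) := by
        rw [norm_mul, singInner_norm, hsplit _ hz, mul_pow, ← Real.exp_nat_mul]
        simp only [A]
        rw [mul_assoc, ← Real.exp_add]
        congr 2
        simp; ring
      rw [e1]
      have e2 := Real.add_one_le_exp (-(2 * (herg μ2 ((circleMap 0 r θ) ^ 2)).re))
      nlinarith [mul_le_mul_of_nonneg_left e2 hA.1, mul_le_mul_of_nonneg_right hA.2 hb]
  have hBi : IntervalIntegrable (fun θ => 2 * C ^ 2 * (herg μ2 ((circleMap 0 r θ) ^ 2)).re) volume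
      0 (2 * Real.pi) := (continuous_const.mul hBc).intervalIntegrable _ _
  rw [intervalIntegral.integral_sub ((hAcont r hr).intervalIntegrable _ _) hBi, intervalIntegral.integral_const_mul, hB]
    at hmono
  have hfin : 2 * C ^ 2 * (2 * Real.pi * ν.real Kᶜ) ≤ 2 * Real.pi * (δ / 2) := by
    have h1 : 2 * C ^ 2 * ν.real Kᶜ ≤ δ / 2 := by
      calc 2 * C ^ 2 * ν.real Kᶜ ≤ 2 * (C ^ 2 + 1) * ε := by gcongr; linarith
        _ = δ / 2 := by rw [hε]; field_simp; norm_num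
    nlinarith
  linarith

lemma taylorCoeff_neg (F : ℂ → ℂ) (n : ℕ) :
    taylorCoeff (fun z => F (-z)) n = (-1) ^ n * taylorCoeff F n := by
  rw [taylorCoeff, taylorCoeff, iteratedDeriv_comp_neg]
  simp; ring

lemma taylorCoeff_even {F : ℂ → ℂ} (hF : AnalyticAt ℂ F 0) (n : ℕ) :
    taylorCoeff (fun z => (1 / 2 : ℂ) * (F z + F (-z))) n =
      (1 / 2) * (taylorCoeff F n + (-1) ^ n * taylorCoeff F n) := by
  have hF' : AnalyticAt ℂ (fun z => F (-z)) 0 :=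
    AnalyticAt.fun_comp (by simpa using hF) (by fun_prop)
  rw [← taylorCoeff_neg]
  unfold taylorCoeff
  rw [iteratedDeriv_const_mul_field]
  have := iteratedDeriv_add (n := n) hF.contDiffAt hF'.contDiffAt
  simp only [Pi.add_def] at this
  rw [this]; ring

lemma memA_f (ω : ℕ → ℝ) (hωeven : ∀ n : ℕ, ω (2 * n) = 1)
    (ν : Measure ℝ) [IsFiniteMeasure ν] : MemA ω (fun z => singInner ν (z ^ 2)) := by
  refine ⟨(f_diff ν).analyticOnNhd Metric.isOpen_ball, ?_⟩
  refine (summable_of_bounded (f_diff ν) (fun z hz => f_le_one ν hz)).congr fun n => ?_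
  rcases Nat.even_or_odd n with h | h
  · obtain ⟨k, rfl⟩ := h.two_dvd
    simp [hωeven]
  · have h1 := taylorCoeff_neg (fun z => singInner ν (z ^ 2)) n
    simp only [neg_sq, h.neg_one_pow] at h1
    have h2 : taylorCoeff (fun z => singInner ν (z ^ 2)) n = 0 := by linear_combination h1 / 2
    simp [h2]

lemma memA_one (ω : ℕ → ℝ) : MemA ω (fun _ => 1) := by
  refine ⟨fun _ _ => analyticAt_const, ?_⟩
  apply summable_of_ne_finset_zero (s := {0})
  intro n hn
  have : n ≠ 0 := by simpa using hn
  simp [taylorCoeff, iteratedDeriv_const, this]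

lemma cyclic_bound (ω : ℕ → ℝ) (hωeven : ∀ n : ℕ, ω (2 * n) = 1)
    (ν : Measure ℝ) [IsFiniteMeasure ν] (hνsing : ν.MutuallySingular volume)
    (h : CyclicA ω (fun z => singInner ν (z ^ 2))) {ε : ℝ} (hε : 0 < ε) :
    1 - ε ≤ (1 + ε) * Real.exp (-ν.real Set.univ) := by
  have hpi := Real.pi_pos
  obtain ⟨p, ⟨hpA, hpS⟩, hpε⟩ := h.2 (fun _ => 1) (memA_one ω) ε hε
  set F : ℂ → ℂ := fun z => p.eval z * singInner ν (z ^ 2) - 1 with hFdef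
  let P : ℂ → ℂ := fun z => (1 / 2 : ℂ) * (p.eval z + p.eval (-z))
  have hP : Differentiable ℂ P := by
    have h1 := p.differentiable
    have h2 : Differentiable ℂ (fun z => p.eval (-z)) := h1.comp differentiable_neg
    exact (h1.add h2).const_mul _
  let G : ℂ → ℂ := fun z => (1 / 2 : ℂ) * (F z + F (-z))
  have hG : ∀ z, G z = P z * singInner ν (z ^ 2) - 1 := by
    intro z; simp only [G, P, F, neg_sq]; ring
  have hGd : DifferentiableOn ℂ G (Metric.ball 0 1) := by
    have : G = fun z => P z * singInner ν (z ^ 2) - 1 := funext hG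
    rw [this]
    exact (hP.differentiableOn.mul (f_diff ν)).sub_const 1
  have hc : ∀ n, ‖taylorCoeff G n‖ ^ 2 ≤ ‖taylorCoeff F n‖ ^ 2 / ω n ^ 2 := by
    intro n
    rw [taylorCoeff_even (hpA 0 (by simp))]
    rcases Nat.even_or_odd n with h | h
    · obtain ⟨k, rfl⟩ := h.two_dvd
      rw [hωeven, h.neg_one_pow]
      apply le_of_eq
      rw [one_pow, div_one]
      congr 2; ring
    · rw [h.neg_one_pow]
      simp
      positivity
  have havg : ∀ r : ℝ, 0 ≤ r → r < 1 →
      (2 * Real.pi)⁻¹ * ∫ θ in (0:ℝ)..2 * Real.pi, ‖G (circleMap 0 r θ)‖ ^ 2 ≤ ε ^ 2 := by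
    intro r h0 h1
    refine le_trans (hasSum_le (fun n => ?_) (parseval_aux hGd h0 h1) hpS.hasSum) hpε.le
    calc ‖taylorCoeff G n‖ ^ 2 * r ^ (2 * n) ≤ ‖taylorCoeff G n‖ ^ 2 * 1 := by
          gcongr
          exact pow_le_one₀ h0 h1.le
      _ ≤ _ := by rw [mul_one]; exact hc n
  have hG0 : ‖G 0‖ ≤ ε := by
    have := havg 0 le_rfl one_pos
    simp at this
    have e : Real.pi⁻¹ * 2⁻¹ * (2 * Real.pi * ‖G 0‖ ^ 2) = ‖G 0‖ ^ 2 := by field_simp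
    rw [e] at this
    exact (pow_le_pow_iff_left₀ (norm_nonneg _) hε.le two_ne_zero).1 this
  have hP0 : ‖P 0‖ ^ 2 ≤ (1 + ε) ^ 2 := by
    apply le_of_forall_pos_le_add
    intro δ hδ
    obtain ⟨r, h0, h1, hr⟩ := inner_lb ν hνsing hP hδ
    have hGc := circle_cont hGd h0.le h1
    have hfc := circle_cont (f_diff ν) h0.le h1
    have hPc := circle_cont (hP.differentiableOn (s := Metric.ball 0 1)) h0.le h1
    have h2 : ∫ θ in (0:ℝ)..2 * Real.pi,
        ‖P (circleMap 0 r θ) * singInner ν ((circleMap 0 r θ) ^ 2)‖ ^ 2 ≤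
        ∫ θ in (0:ℝ)..2 * Real.pi, ((1 + 1 / ε) * ‖G (circleMap 0 r θ)‖ ^ 2 + (1 + ε)) := by
      apply intervalIntegral.integral_mono_on (by positivity)
      · exact ((hPc.mul hfc).norm.pow 2).intervalIntegrable _ _
      · exact ((continuous_const.mul (hGc.norm.pow 2)).add continuous_const).intervalIntegrable _ _
      · intro θ _
        have e : P (circleMap 0 r θ) * singInner ν ((circleMap 0 r θ) ^ 2) =
          G (circleMap 0 r θ) + 1 := by rw [hG]; ring
        rw [e]
        have e1 : ‖G (circleMap 0 r θ) + 1‖ ≤ ‖G (circleMap 0 r θ)‖ + 1 := by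
          simpa using norm_add_le (G (circleMap 0 r θ)) 1
        generalize ‖G (circleMap 0 r θ)‖ = x at *
        have e2 : (1 + 1 / ε) * x ^ 2 + (1 + ε) - (x + 1) ^ 2 = (x - ε) ^ 2 / ε := by
          field_simp; ring
        have e3 : 0 ≤ (x - ε) ^ 2 / ε := by positivity
        have e4 : ‖G (circleMap 0 r θ) + 1‖ ^ 2 ≤ (x + 1) ^ 2 := by gcongr
        linarith
    have hGi : IntervalIntegrable (fun θ => (1 + 1 / ε) * ‖G (circleMap 0 r θ)‖ ^ 2) volume
        0 (2 * Real.pi) := (continuous_const.mul (hGc.norm.pow 2)).intervalIntegrable _ _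
    rw [intervalIntegral.integral_add hGi intervalIntegrable_const,
      intervalIntegral.integral_const_mul, intervalIntegral.integral_const] at h2
    have h3 := havg r h0.le h1
    have h4 : ∫ θ in (0:ℝ)..2 * Real.pi, ‖G (circleMap 0 r θ)‖ ^ 2 ≤ 2 * Real.pi * ε ^ 2 := by
      rwa [inv_mul_le_iff₀ (by positivity)] at h3
    have h5 : (1 + 1 / ε) * ∫ θ in (0:ℝ)..2 * Real.pi, ‖G (circleMap 0 r θ)‖ ^ 2 ≤
        (1 + 1 / ε) * (2 * Real.pi * ε ^ 2) := by gcongr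
    have h6 : (1 + 1 / ε) * (2 * Real.pi * ε ^ 2) = 2 * Real.pi * (ε ^ 2 + ε) := by
      field_simp
    simp only [sub_zero, smul_eq_mul] at h2
    have h7 : 2 * Real.pi * (‖P 0‖ ^ 2 - δ) ≤ 2 * Real.pi * (1 + ε) ^ 2 := by
      nlinarith
    have h8 := le_of_mul_le_mul_left h7 (by positivity)
    linarith
  have hP0' : ‖P 0‖ ≤ 1 + ε := (pow_le_pow_iff_left₀ (norm_nonneg _) (by positivity) two_ne_zero).1 hP0
  have hf0 : ‖singInner ν (0 ^ 2)‖ = Real.exp (-ν.real Set.univ) := by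
    rw [singInner_norm]; simp [herg_zero]
  have h1 : 1 - ‖G 0‖ ≤ ‖P 0‖ * ‖singInner ν (0 ^ 2)‖ := by
    rw [← norm_mul]
    have e : (1:ℂ) = P 0 * singInner ν (0 ^ 2) - G 0 := by rw [hG]; ring
    have := norm_sub_le (P 0 * singInner ν (0 ^ 2)) (G 0)
    rw [← e, norm_one] at this
    linarith
  rw [hf0] at h1
  calc 1 - ε ≤ ‖P 0‖ * Real.exp (-ν.real Set.univ) := by linarith
    _ ≤ _ := by gcongr

/-- If `ω(2n) = 1` for every `n`, then for every nonzero singular measure `ν`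
with associated singular inner function `U`, the function `z ↦ U(z²)` belongs
to `A²_ω` but is not cyclic in `A²_ω`. -/
theorem not_cyclic_of_even_weight_one
    (ω : ℕ → ℝ) (hωpos : ∀ n, 0 < ω n) (hωeven : ∀ n : ℕ, ω (2 * n) = 1)
    (ν : Measure ℝ) [IsFiniteMeasure ν] (hν0 : ν ≠ 0)
    (hνsing : ν.MutuallySingular volume)
    (hνsupp : ν (Set.Ico 0 (2 * Real.pi))ᶜ = 0) :
    MemA ω (fun z => singInner ν (z ^ 2)) ∧
      ¬ CyclicA ω (fun z => singInner ν (z ^ 2)) := by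
  refine ⟨memA_f ω hωeven ν, fun h => ?_⟩
  have hm : 0 < ν.real Set.univ := by
    rw [measureReal_def, ENNReal.toReal_pos_iff]
    exact ⟨by simpa [pos_iff_ne_zero] using hν0, measure_lt_top _ _⟩
  have hE : Real.exp (-ν.real Set.univ) < 1 := by
    rw [Real.exp_lt_one_iff]; linarith
  set E := Real.exp (-ν.real Set.univ)
  have hE0 : 0 < E := Real.exp_pos _
  have := cyclic_bound ω hωeven ν hνsing h (ε := (1 - E) / 4) (by linarith)
  change 1 - (1 - E) / 4 ≤ (1 + (1 - E) / 4) * E at this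
  nlinarith
end
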